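/- arXiv:2601.12163 — 8 statements merged into one kernel-verified Lean document; each statement's English description precedes it below -/
import Mathlib

section
/- (Strict form of the critical value bound; Corollary 4.6 of the paper with |wmax(Q)| replaced by its lower bound λ(d)) Let d ≥ 2 be an integer with λ(d) > 0, and let Q = f/g be a rational map over K of degree d satisfying Q(∞) = ∞ (deg f > deg g). Let z0 ∈ K be neither a pole nor a critical point of Q, i.e. g(z0) ≠ 0 and (f′g − fg′)(z0) ≠ 0, and let r_• := min{|w − z0| : w ∈ S} where S := {w ∈ K : g(w) = 0, or (g(w) ≠ 0, Q(w) = Q(z0) and w ≠ z0)} (this set is nonempty since d ≥ 2 and z0 is a simple root of f − Q(z0)·g). Then Q has a finite critical value v, i.e. v = Q(c) for some c ∈ K with g(c) ≠ 0 and (f′g − fg′)(c) = 0, satisfying 0 < |v − Q(z0)| ≤ λ(d)^{−d}·|Q'(z0)|·r_•. -/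
open Polynomial Filter

/-- `lam K d = min {‖(m : K)‖ : m ∈ {1, …, d}}`. -/
noncomputable def lam (K : Type*) [NormedField K] (d : ℕ) : ℝ :=
  ⨅ m : Finset.Icc 1 d, ‖((m : ℕ) : K)‖

section walk
variable {K : Type*} [NontriviallyNormedField K] [IsUltrametricDist K]

noncomputable def MM (S : Finset K) (k : K → ℤ) (a : K) (s : ℝ) : ℝ :=
  ∏ x ∈ S, (max s ‖a - x‖) ^ (k x)

theorem MM_pos (S : Finset K) (k : K → ℤ) (a : K) {s : ℝ} (hs : 0 < s) : 0 < MM S k a s :=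
  Finset.prod_pos fun x _ => zpow_pos (lt_max_of_lt_left hs) _

theorem max_recenter {a b x : K} {s : ℝ} (h : ‖a - b‖ ≤ s) :
    max s ‖a - x‖ = max s ‖b - x‖ := by
  have h1 : ‖a - x‖ ≤ max ‖a - b‖ ‖b - x‖ := by
    simpa using IsUltrametricDist.norm_add_le_max (a - b) (b - x)
  have h2 : ‖b - x‖ ≤ max ‖b - a‖ ‖a - x‖ := by
    simpa using IsUltrametricDist.norm_add_le_max (b - a) (a - x)
  rw [norm_sub_rev b a] at h2
  apply le_antisymm
  · exact max_le (le_max_left _ _) (h1.trans (max_le_max h le_rfl))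
  · exact max_le (le_max_left _ _) (h2.trans (max_le_max h le_rfl))

theorem lt_recenter {a b x : K} {s : ℝ} (h : ‖a - b‖ < s) :
    ‖a - x‖ < s ↔ ‖b - x‖ < s := by
  have h1 : ‖a - x‖ ≤ max ‖a - b‖ ‖b - x‖ := by
    simpa using IsUltrametricDist.norm_add_le_max (a - b) (b - x)
  have h2 : ‖b - x‖ ≤ max ‖b - a‖ ‖a - x‖ := by
    simpa using IsUltrametricDist.norm_add_le_max (b - a) (a - x)
  rw [norm_sub_rev b a] at h2
  exact ⟨fun h3 => h2.trans_lt (max_lt h h3), fun h3 => h1.trans_lt (max_lt h h3)⟩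

theorem le_recenter {a b x : K} {s : ℝ} (h : ‖a - b‖ ≤ s) :
    ‖a - x‖ ≤ s ↔ ‖b - x‖ ≤ s := by
  have := max_recenter (x := x) h
  rw [← max_eq_left_iff, this, max_eq_left_iff]

theorem MM_recenter (S : Finset K) (k : K → ℤ) {a b : K} {s : ℝ} (h : ‖a - b‖ ≤ s) :
    MM S k a s = MM S k b s := by
  unfold MM
  exact Finset.prod_congr rfl fun x _ => by rw [max_recenter h]

theorem MM_step (S : Finset K) (k : K → ℤ) (a : K) {s₁ s₂ : ℝ} (h1 : 0 < s₁) (h12 : s₁ < s₂)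
    (hS : ∀ x ∈ S, ‖a - x‖ ≤ s₁ ∨ s₂ ≤ ‖a - x‖) :
    MM S k a s₂ = MM S k a s₁ * (s₂ / s₁) ^ (∑ x ∈ S with ‖a - x‖ ≤ s₁, k x) := by
  have hpos : 0 < s₂ / s₁ := div_pos (h1.trans h12) h1
  have : (s₂ / s₁) ^ (∑ x ∈ S with ‖a - x‖ ≤ s₁, k x)
      = ∏ x ∈ S, if ‖a - x‖ ≤ s₁ then (s₂ / s₁) ^ (k x) else 1 := by
    rw [← Finset.prod_filter]
    generalize (Finset.filter (fun x => ‖a - x‖ ≤ s₁) S) = U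
    induction U using Finset.cons_induction with
    | empty => simp
    | cons x U hx ih => rw [Finset.sum_cons, Finset.prod_cons, zpow_add₀ hpos.ne', ih]
  unfold MM
  rw [this, ← Finset.prod_mul_distrib]
  refine Finset.prod_congr rfl fun x hx => ?_
  rcases hS x hx with h | h
  · rw [if_pos h, max_eq_left h, max_eq_left (h.trans h12.le), ← mul_zpow]
    congr 1
    field_simp
  · rw [if_neg (by linarith), max_eq_right h, max_eq_right (h12.le.trans h), mul_one]

theorem pigeon (w : K → ℤ) (s : ℝ) (hs : 0 < s) (n : ℕ) : ∀ (X : Finset K), X.card ≤ n → X.Nonempty →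
    0 ≤ ∑ x ∈ X, w x → ∃ b ∈ X, 0 ≤ ∑ x ∈ X with ‖b - x‖ < s, w x := by
  induction n with
  | zero => intro X h1 h2; have := h2.card_pos; omega
  | succ n ih =>
    intro X h1 h2 h3
    by_contra! hcon
    obtain ⟨b, hb⟩ := h2
    have hb' := hcon b hb
    have hsum := Finset.sum_filter_add_sum_filter_not X (fun x => ‖b - x‖ < s) w
    have hlt : (Finset.filter (fun x => ¬ ‖b - x‖ < s) X).card < X.card := by
      apply Finset.card_lt_card
      refine Finset.filter_ssubset.2 ⟨b, hb, by simpa using hs⟩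
    rcases Finset.eq_empty_or_nonempty (Finset.filter (fun x => ¬ ‖b - x‖ < s) X) with h0 | h0
    · rw [h0, Finset.sum_empty] at hsum
      omega
    · obtain ⟨b', hb1, hb2⟩ := ih _ (by omega) h0 (by omega)
      rw [Finset.mem_filter] at hb1
      have h4 := hcon b' hb1.1
      have : Finset.filter (fun x => ‖b' - x‖ < s) (Finset.filter (fun x => ¬ ‖b - x‖ < s) X)
         = Finset.filter (fun x => ‖b' - x‖ < s) X := by
        ext x
        simp only [Finset.mem_filter]
        constructor
        · tauto
        · rintro ⟨hx, hx'⟩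
          refine ⟨⟨hx, fun h => hb1.2 ?_⟩, hx'⟩
          have := (lt_recenter (x := b') h).2
          rw [norm_sub_rev x b'] at this
          exact this hx'
      rw [this] at hb2
      omega

structure Good (S : Finset K) (w μ : K → ℤ) (C R l : ℝ) (d : ℕ) (a : K) (s : ℝ) : Prop where
  pos : 0 < s
  h1 : MM S μ a s * (C * s * MM S w a s) ^ d ≤ R
  h2 : MM S μ a s ≤ R / l ^ d

theorem Good.recenter {S : Finset K} {w μ : K → ℤ} {C R l : ℝ} {d : ℕ} {a b : K} {s : ℝ}
    (h : Good S w μ C R l d a s) (hab : ‖a - b‖ ≤ s) : Good S w μ C R l d b s := by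
  obtain ⟨h0, h1, h2⟩ := h
  rw [MM_recenter S μ hab] at h1 h2
  rw [MM_recenter S w hab] at h1
  exact ⟨h0, h1, h2⟩

/-- abstract step -/
theorem real_step {G1 G2 E1 E2 q R l : ℝ} {d : ℕ} (hq : 1 ≤ q) (ν : ℤ) (hν : ν ≤ d)
    (hG1 : 0 < G1) (hE1 : 0 < E1) (hE2 : 0 < E2) (hl : 0 < l)
    (hG : G2 = G1 * q ^ ν) (hE : E2 * q ≤ E1) (h1 : G1 * E1 ^ d ≤ R) (h2 : G1 ≤ R / l ^ d)
    (hN : ν ≠ 0 → l ≤ E2) : G2 * E2 ^ d ≤ R ∧ G2 ≤ R / l ^ d := by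
  have hq0 : 0 < q := by linarith
  have hG2 : G2 ≤ G1 * q ^ d := by
    rw [hG]
    have : q ^ ν ≤ q ^ (d : ℤ) := zpow_le_zpow_right₀ hq hν
    rw [zpow_natCast] at this
    gcongr
  have hG2' : 0 < G2 := by rw [hG]; positivity
  have A : G2 * E2 ^ d ≤ R := by
    calc G2 * E2 ^ d ≤ G1 * q ^ d * E2 ^ d := by gcongr
      _ = G1 * (E2 * q) ^ d := by rw [mul_pow]; ring
      _ ≤ G1 * E1 ^ d := by gcongr
      _ ≤ R := h1
  refine ⟨A, ?_⟩
  by_cases h : ν = 0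
  · rw [hG, h]; simpa using h2
  · rw [le_div_iff₀ (by positivity)]
    have := hN h
    calc G2 * l ^ d ≤ G2 * E2 ^ d := by gcongr
      _ ≤ R := A

variable (S : Finset K) (w μ : K → ℤ) (C R l : ℝ) (d : ℕ)

def HN : Prop := ∀ (a : K) (s₁ s₂ : ℝ), 0 < s₁ → s₁ < s₂ →
  (∀ x ∈ S, ‖a - x‖ ≤ s₁ ∨ s₂ ≤ ‖a - x‖) →
  (∑ x ∈ S with ‖a - x‖ ≤ s₁, μ x) ≠ 0 → l ≤ C * s₁ * MM S w a s₁ ∧ l ≤ C * s₂ * MM S w a s₂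

theorem good_up (hC : 0 < C) (hl : 0 < l) (hb : ∀ U ⊆ S, |∑ x ∈ U, μ x| ≤ d)
    (hN : HN S w μ C l) {a : K} {s₁ s₂ : ℝ} (h12 : s₁ < s₂)
    (hS : ∀ x ∈ S, ‖a - x‖ ≤ s₁ ∨ s₂ ≤ ‖a - x‖)
    (he : (∑ x ∈ S with ‖a - x‖ ≤ s₁, w x) ≤ -2) (hg : Good S w μ C R l d a s₁) :
    Good S w μ C R l d a s₂ := by
  obtain ⟨h0, h1, h2⟩ := hg
  have h02 := h0.trans h12
  have hw := MM_step S w a h0 h12 hS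
  have hμ := MM_step S μ a h0 h12 hS
  have p1 := MM_pos S w a h0
  have p2 := MM_pos S w a h02
  have p3 := MM_pos S μ a h0
  have hq : 1 ≤ s₂ / s₁ := by rw [one_le_div h0]; exact h12.le
  have hq0 : 0 < s₂ / s₁ := by positivity
  obtain ⟨A, B⟩ := real_step (E1 := C * s₁ * MM S w a s₁) (E2 := C * s₂ * MM S w a s₂) hq _
    (abs_le.1 (hb _ (Finset.filter_subset (fun x => ‖a - x‖ ≤ s₁) S))).2
    p3 (by positivity) (by positivity) hl hμ (by
      rw [hw]
      have : (s₂ / s₁) ^ (∑ x ∈ S with ‖a - x‖ ≤ s₁, w x) ≤ (s₂ / s₁) ^ (-2 : ℤ) :=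
        zpow_le_zpow_right₀ hq he
      calc C * s₂ * (MM S w a s₁ * (s₂ / s₁) ^ (∑ x ∈ S with ‖a - x‖ ≤ s₁, w x)) * (s₂ / s₁)
          ≤ C * s₂ * (MM S w a s₁ * (s₂ / s₁) ^ (-2 : ℤ)) * (s₂ / s₁) := by gcongr
        _ = C * s₁ * MM S w a s₁ := by
          have e : (s₂ / s₁) ^ (-2 : ℤ) = ((s₂ / s₁) ^ 2)⁻¹ := by
            rw [zpow_neg]; norm_cast
          rw [e]
          field_simp) h1 h2 (fun h => (hN a s₁ s₂ h0 h12 hS h).2)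
  exact ⟨h02, A, B⟩

theorem good_down (hC : 0 < C) (hl : 0 < l) (hb : ∀ U ⊆ S, |∑ x ∈ U, μ x| ≤ d)
    (hN : HN S w μ C l) {a : K} {s₁ s₂ : ℝ} (h0 : 0 < s₁) (h12 : s₁ < s₂)
    (hS : ∀ x ∈ S, ‖a - x‖ ≤ s₁ ∨ s₂ ≤ ‖a - x‖)
    (he : 0 ≤ (∑ x ∈ S with ‖a - x‖ ≤ s₁, w x)) (hg : Good S w μ C R l d a s₂) :
    Good S w μ C R l d a s₁ := by
  obtain ⟨h02, h1, h2⟩ := hg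
  have hw := MM_step S w a h0 h12 hS
  have hμ := MM_step S μ a h0 h12 hS
  have p1 := MM_pos S w a h0
  have p2 := MM_pos S w a h02
  have p3 := MM_pos S μ a h0
  have p4 := MM_pos S μ a h02
  have hq : 1 ≤ s₂ / s₁ := by rw [one_le_div h0]; exact h12.le
  have hq0 : 0 < s₂ / s₁ := by positivity
  have hbb := (abs_le.1 (hb _ (Finset.filter_subset (fun x => ‖a - x‖ ≤ s₁) S))).1
  obtain ⟨A, B⟩ := real_step (G2 := MM S μ a s₁)
    (E1 := C * s₂ * MM S w a s₂) (E2 := C * s₁ * MM S w a s₁) hq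
    (- ∑ x ∈ S with ‖a - x‖ ≤ s₁, μ x) (by linarith)
    p4 (by positivity) (by positivity) hl (by
      rw [hμ, mul_assoc, ← zpow_add₀ hq0.ne']; simp) (by
      rw [hw]
      have : 1 ≤ (s₂ / s₁) ^ (∑ x ∈ S with ‖a - x‖ ≤ s₁, w x) := one_le_zpow₀ hq he
      calc C * s₁ * MM S w a s₁ * (s₂ / s₁) = C * s₂ * (MM S w a s₁ * 1) := by field_simp
        _ ≤ _ := by gcongr) h1 h2 (fun h => (hN a s₁ s₂ h0 h12 hS (by simpa using h)).1)
  exact ⟨h0, A, B⟩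

theorem walk_down (hC : 0 < C) (hl : 0 < l) (hb : ∀ U ⊆ S, |∑ x ∈ U, μ x| ≤ d)
    (hN : HN S w μ C l) (hw : ∀ x ∈ S, (0 < w x ∧ μ x = 0) ∨ w x < 0) (n : ℕ) :
    ∀ (a : K) (s : ℝ), Good S w μ C R l d a s → (S.filter (fun x => ‖a - x‖ < s)).card ≤ n →
      (S.filter (fun x => ‖a - x‖ < s)).Nonempty → 0 ≤ ∑ x ∈ S with ‖a - x‖ < s, w x →
      ∃ c ∈ S, 0 < w c ∧ ∏ x ∈ S, ‖c - x‖ ^ (μ x) ≤ R / l ^ d := by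
  induction n with
  | zero => intro a s _ h1 h2; have := h2.card_pos; omega
  | succ n ih =>
    intro a s hg hn hne he
    by_cases hneg : ∀ x ∈ S.filter (fun x => ‖a - x‖ < s), 0 < w x
    · obtain ⟨c, hc⟩ := hne
      have hc' := hc
      rw [Finset.mem_filter] at hc
      refine ⟨c, hc.1, hneg c hc', ?_⟩
      refine le_trans (le_of_eq ?_) (hg.recenter hc.2.le).h2
      refine Finset.prod_congr rfl fun x hx => ?_
      rcases hw x hx with h | h
      · rw [h.2]; simp
      · rw [max_eq_right]
        by_contra! hlt
        have := hneg x (Finset.mem_filter.2 ⟨hx, (lt_recenter hc.2).2 hlt⟩)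
        omega
    · push Not at hneg
      obtain ⟨b, hb1, hb2⟩ := hneg
      have hb1' := Finset.mem_filter.1 hb1
      have hbneg : w b < 0 := by
        rcases hw b hb1'.1 with h | h <;> omega
      have hH : S.filter (fun x => ‖a - x‖ < s) = S.filter (fun x => ‖b - x‖ < s) :=
        Finset.filter_congr fun x _ => lt_recenter hb1'.2
      have hgb := hg.recenter hb1'.2.le
      rw [hH] at hn hne he hb1
      set H := S.filter (fun x => ‖b - x‖ < s) with hHdef
      obtain ⟨y, hy1, hy2⟩ : ∃ y ∈ H, 0 ≤ w y := by
        by_contra! hcon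
        have := Finset.sum_neg hcon hne
        omega
      have hyb : b ≠ y := by rintro rfl; omega
      obtain ⟨m, hm1, hm2⟩ := Finset.exists_max_image H (fun x => ‖b - x‖) hne
      set s₁ := ‖b - m‖
      have hs1 : 0 < s₁ := lt_of_lt_of_le (norm_pos_iff.2 (sub_ne_zero.2 hyb)) (hm2 y hy1)
      have hs1s : s₁ < s := (Finset.mem_filter.1 hm1).2
      have hS : ∀ x ∈ S, ‖b - x‖ ≤ s₁ ∨ s ≤ ‖b - x‖ := by
        intro x hx
        by_cases h : ‖b - x‖ < s
        · exact Or.inl (hm2 x (Finset.mem_filter.2 ⟨hx, h⟩))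
        · exact Or.inr (not_lt.1 h)
      have hHH : S.filter (fun x => ‖b - x‖ ≤ s₁) = H := by
        refine Finset.filter_congr fun x hx => ⟨fun h => h.trans_lt hs1s, fun h => ?_⟩
        rcases hS x hx with h' | h'
        · exact h'
        · linarith
      have hg1 := good_down S w μ C R l d hC hl hb hN hs1 hs1s hS (by rw [hHH]; exact he) hgb
      obtain ⟨b', hb'1, hb'2⟩ := pigeon w s₁ hs1 _ H le_rfl hne he
      have hbb' : ‖b - b'‖ ≤ s₁ := hm2 b' hb'1
      have hsub : H.filter (fun x => ‖b' - x‖ < s₁) = S.filter (fun x => ‖b' - x‖ < s₁) := by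
        rw [← hHH, Finset.filter_filter]
        refine Finset.filter_congr fun x hx => ⟨fun h => h.2, fun h => ⟨?_, h⟩⟩
        exact (le_recenter hbb').2 h.le
      have hlt : (H.filter (fun x => ‖b' - x‖ < s₁)).card < H.card := by
        apply Finset.card_lt_card
        rw [Finset.filter_ssubset]
        by_contra! hcon
        have h1 := hcon m hm1
        have h2 := hcon b hb1
        have := (lt_recenter (x := m) h2).1 h1
        exact lt_irrefl _ this
      refine ih b' s₁ (hg1.recenter hbb') ?_ ⟨b', ?_⟩ ?_
      · rw [← hsub]; omega
      · rw [← hsub]; exact Finset.mem_filter.2 ⟨hb'1, by simpa using hs1⟩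
      · rw [← hsub]; exact hb'2

theorem turn (hC : 0 < C) (hl : 0 < l) (hb : ∀ U ⊆ S, |∑ x ∈ U, μ x| ≤ d)
    (hN : HN S w μ C l) (hw : ∀ x ∈ S, (0 < w x ∧ μ x = 0) ∨ w x < 0) (a : K) (s : ℝ)
    (hg : Good S w μ C R l d a s) (hne : ∃ x ∈ S, ‖a - x‖ = s)
    (he : ∑ x ∈ S with ‖a - x‖ < s, w x ≤ ∑ x ∈ S with ‖a - x‖ ≤ s, w x) :
    ∃ c ∈ S, 0 < w c ∧ ∏ x ∈ S, ‖c - x‖ ^ (μ x) ≤ R / l ^ d := by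
  set X := S.filter (fun x => ‖a - x‖ = s) with hX
  have hXn : X.Nonempty := by
    obtain ⟨x, h1, h2⟩ := hne
    exact ⟨x, Finset.mem_filter.2 ⟨h1, h2⟩⟩
  have hsum : 0 ≤ ∑ x ∈ X, w x := by
    have := Finset.sum_filter_add_sum_filter_not (S.filter (fun x => ‖a - x‖ ≤ s))
      (fun x => ‖a - x‖ < s) w
    rw [Finset.filter_filter, Finset.filter_filter] at this
    have e1 : S.filter (fun x => ‖a - x‖ ≤ s ∧ ‖a - x‖ < s) = S.filter (fun x => ‖a - x‖ < s) :=
      Finset.filter_congr fun x _ => ⟨fun h => h.2, fun h => ⟨h.le, h⟩⟩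
    have e2 : S.filter (fun x => ‖a - x‖ ≤ s ∧ ¬ ‖a - x‖ < s) = X :=
      Finset.filter_congr fun x _ => ⟨fun h => le_antisymm h.1 (not_lt.1 h.2),
        fun h => ⟨h.le, by linarith⟩⟩
    rw [e1, e2] at this
    omega
  obtain ⟨b, hb1, hb2⟩ := pigeon w s hg.pos _ X le_rfl hXn hsum
  have hb1' := Finset.mem_filter.1 hb1
  have hsub : X.filter (fun x => ‖b - x‖ < s) = S.filter (fun x => ‖b - x‖ < s) := by
    rw [hX, Finset.filter_filter]
    refine Finset.filter_congr fun x hx => ⟨fun h => h.2, fun h => ⟨?_, h⟩⟩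
    have h1 : ‖a - x‖ ≤ s := (le_recenter hb1'.2.le).2 h.le
    refine le_antisymm h1 ?_
    by_contra! hlt
    rw [norm_sub_rev] at h hlt
    have := (lt_recenter (x := a) h).1 hlt
    rw [norm_sub_rev] at this
    linarith [hb1'.2]
  refine walk_down S w μ C R l d hC hl hb hN hw _ b s (hg.recenter hb1'.2.le) le_rfl ⟨b, ?_⟩ ?_
  · exact Finset.mem_filter.2 ⟨hb1'.1, by simpa using hg.pos⟩
  · rw [← hsub]; exact hb2

theorem walk_up (hC : 0 < C) (hl : 0 < l) (hb : ∀ U ⊆ S, |∑ x ∈ U, μ x| ≤ d)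
    (hN : HN S w μ C l) (hw : ∀ x ∈ S, (0 < w x ∧ μ x = 0) ∨ w x < 0)
    (htot : ∑ x ∈ S, w x = -1) (a : K) (n : ℕ) :
    ∀ (s : ℝ), Good S w μ C R l d a s → (S.filter (fun x => s < ‖a - x‖)).card ≤ n →
      ∑ x ∈ S with ‖a - x‖ ≤ s, w x ≤ -2 →
      ∃ c ∈ S, 0 < w c ∧ ∏ x ∈ S, ‖c - x‖ ^ (μ x) ≤ R / l ^ d := by
  induction n with
  | zero =>
    intro s _ h1 h2
    have h0 : S.filter (fun x => s < ‖a - x‖) = ∅ := Finset.card_eq_zero.1 (by omega)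
    have : S.filter (fun x => ‖a - x‖ ≤ s) = S := by
      refine Finset.filter_true_of_mem fun x hx => ?_
      by_contra! hcon
      have : x ∈ S.filter (fun x => s < ‖a - x‖) := Finset.mem_filter.2 ⟨hx, hcon⟩
      rw [h0] at this
      simp at this
    rw [this] at h2
    omega
  | succ n ih =>
    intro s hg hn he
    rcases Finset.eq_empty_or_nonempty (S.filter (fun x => s < ‖a - x‖)) with h0 | h0
    · exact ih s hg (by rw [h0]; simp) he
    obtain ⟨m, hm1, hm2⟩ := Finset.exists_min_image _ (fun x => ‖a - x‖) h0
    have hm1' := Finset.mem_filter.1 hm1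
    set s₂ := ‖a - m‖
    have hS : ∀ x ∈ S, ‖a - x‖ ≤ s ∨ s₂ ≤ ‖a - x‖ := by
      intro x hx
      by_cases h : ‖a - x‖ ≤ s
      · exact Or.inl h
      · exact Or.inr (hm2 x (Finset.mem_filter.2 ⟨hx, not_le.1 h⟩))
    have hg2 := good_up S w μ C R l d hC hl hb hN hm1'.2 hS he hg
    by_cases he2 : ∑ x ∈ S with ‖a - x‖ ≤ s₂, w x ≤ -2
    · refine ih s₂ hg2 ?_ he2
      have : (S.filter (fun x => s₂ < ‖a - x‖)).card < (S.filter (fun x => s < ‖a - x‖)).card := by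
        apply Finset.card_lt_card
        rw [Finset.ssubset_iff_of_subset]
        · exact ⟨m, hm1, by simp [s₂]⟩
        · intro x hx
          rw [Finset.mem_filter] at hx ⊢
          exact ⟨hx.1, hm1'.2.trans hx.2⟩
      omega
    · refine turn S w μ C R l d hC hl hb hN hw a s₂ hg2 ⟨m, hm1'.1, rfl⟩ ?_
      have : S.filter (fun x => ‖a - x‖ < s₂) = S.filter (fun x => ‖a - x‖ ≤ s) := by
        refine Finset.filter_congr fun x hx => ⟨fun h => ?_, fun h => h.trans_lt hm1'.2⟩
        rcases hS x hx with h' | h'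
        · exact h'
        · linarith
      rw [this]
      omega

theorem walk (hC : 0 < C) (hl : 0 < l) (hb : ∀ U ⊆ S, |∑ x ∈ U, μ x| ≤ d)
    (hN : HN S w μ C l) (hw : ∀ x ∈ S, (0 < w x ∧ μ x = 0) ∨ w x < 0)
    (htot : ∑ x ∈ S, w x = -1) (a : K) (r : ℝ) (hg : Good S w μ C R l d a r)
    (hne : ∃ x ∈ S, ‖a - x‖ = r) (h1 : ∑ x ∈ S with ‖a - x‖ < r, w x = -1) :
    ∃ c ∈ S, 0 < w c ∧ ∏ x ∈ S, ‖c - x‖ ^ (μ x) ≤ R / l ^ d := by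
  by_cases he : ∑ x ∈ S with ‖a - x‖ ≤ r, w x ≤ -2
  · exact walk_up S w μ C R l d hC hl hb hN hw htot a _ r hg le_rfl he
  · exact turn S w μ C R l d hC hl hb hN hw a r hg hne (by omega)

end walk
section lemN
variable {K : Type*} [NontriviallyNormedField K] [IsAlgClosed K] [IsUltrametricDist K]

theorem avg_id (t y : K) (N : ℕ) (hN : 0 < N) (hy : y ^ N ≠ t ^ N) :
    ((X ^ N - C (t ^ N) : K[X]).roots.map (fun w => w / (w - y))).sum
      = N * (t ^ N / (t ^ N - y ^ N)) := by
  set p : K[X] := X ^ N - C (t ^ N) with hp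
  have hs : p.Splits := IsAlgClosed.splits p
  have hp0 : p.eval y ≠ 0 := by simpa [hp, sub_eq_zero] using hy
  have hd : p.natDegree = N := natDegree_X_pow_sub_C
  have hcard : p.roots.card = N := by rw [← hd]; exact hs.natDegree_eq_card_roots.symm
  have h1 := hs.eval_derivative_div_eval_of_ne_zero hp0
  have h2 : ∀ w ∈ p.roots, w / (w - y) = 1 - y * (1 / (y - w)) := by
    intro w hw
    have hw' : w ≠ y := by
      rintro rfl
      exact hp0 (isRoot_of_mem_roots hw)
    have a1 : w - y ≠ 0 := sub_ne_zero.2 hw'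
    have a2 : y - w ≠ 0 := sub_ne_zero.2 hw'.symm
    field_simp
    ring
  rw [Multiset.map_congr rfl h2, Multiset.sum_map_sub, Multiset.sum_map_mul_left, ← h1]
  have e1 : p.eval y = y ^ N - t ^ N := by simp [hp]
  have e2 : p.derivative.eval y = N * y ^ (N - 1) := by
    rw [hp, derivative_sub, derivative_C, derivative_X_pow]; simp
  rw [e1, e2]
  have a1 : y ^ N - t ^ N ≠ 0 := sub_ne_zero.2 hy
  have a2 : t ^ N - y ^ N ≠ 0 := sub_ne_zero.2 hy.symm
  simp only [Multiset.map_const', Multiset.sum_replicate, hcard, nsmul_eq_mul, mul_one]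
  obtain ⟨M, rfl⟩ : ∃ M, N = M + 1 := ⟨N - 1, by omega⟩
  simp only [Nat.add_sub_cancel]
  field_simp
  ring

theorem norm_msum_le (m : Multiset K) (F : K → K) (B : ℝ) (hB : 0 ≤ B) (h : ∀ w ∈ m, ‖F w‖ ≤ B) :
    ‖(m.map F).sum‖ ≤ B := by
  induction m using Multiset.induction_on with
  | empty => simpa using hB
  | cons a m ih =>
    rw [Multiset.map_cons, Multiset.sum_cons]
    refine (IsUltrametricDist.norm_add_le_max _ _).trans (max_le (h a (by simp)) (ih ?_))
    intro w hw
    exact h w (by simp [hw])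

theorem lim_inside (t y : K) (ht : t ≠ 0) (h : ‖y‖ < ‖t‖) :
    Tendsto (fun N : ℕ => t ^ N / (t ^ N - y ^ N)) atTop (nhds 1) := by
  have h1 : Tendsto (fun N : ℕ => (y / t) ^ N) atTop (nhds 0) := by
    apply tendsto_pow_atTop_nhds_zero_of_norm_lt_one
    rw [norm_div, div_lt_one (norm_pos_iff.2 ht)]; exact h
  have h2 : Tendsto (fun N : ℕ => (1 - (y / t) ^ N)⁻¹) atTop (nhds 1) := by
    have := (h1.const_sub 1).inv₀ (by simp)
    simpa using this
  refine h2.congr fun N => ?_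
  have : t ^ N ≠ 0 := pow_ne_zero _ ht
  rw [div_pow]
  rw [show 1 - y ^ N / t ^ N = (t ^ N - y ^ N) / t ^ N by field_simp, inv_div]

theorem lim_outside (t y : K) (h : ‖t‖ < ‖y‖) :
    Tendsto (fun N : ℕ => t ^ N / (t ^ N - y ^ N)) atTop (nhds 0) := by
  have hy : y ≠ 0 := norm_pos_iff.1 ((norm_nonneg t).trans_lt h)
  have h1 : Tendsto (fun N : ℕ => (t / y) ^ N) atTop (nhds 0) := by
    apply tendsto_pow_atTop_nhds_zero_of_norm_lt_one
    rw [norm_div, div_lt_one (norm_pos_iff.2 hy)]; exact h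
  have h2 : Tendsto (fun N : ℕ => (t / y) ^ N / ((t / y) ^ N - 1)) atTop (nhds 0) := by
    have := h1.div (h1.sub_const 1) (by simp)
    rw [zero_div] at this
    exact this
  refine h2.congr fun N => ?_
  have : y ^ N ≠ 0 := pow_ne_zero _ hy
  rw [div_pow]
  rw [show t ^ N / y ^ N - 1 = (t ^ N - y ^ N) / y ^ N by field_simp, div_div_div_cancel_right₀ this]

theorem freq_norm_one : ∃ᶠ N : ℕ in atTop, 0 < N ∧ ‖(N : K)‖ = 1 := by
  rw [frequently_atTop]
  intro n
  have h1 : ∀ m : ℕ, ‖(m : K)‖ ≤ 1 := fun m => IsUltrametricDist.norm_natCast_le_one K m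
  by_cases h : ‖((n + 1 : ℕ) : K)‖ = 1
  · exact ⟨n + 1, by omega, by omega, h⟩
  · refine ⟨n + 2, by omega, by omega, le_antisymm (h1 _) ?_⟩
    have h2 : ‖((n + 1 : ℕ) : K)‖ < 1 := lt_of_le_of_ne (h1 _) h
    have h3 : (1 : K) = ((n + 2 : ℕ) : K) - ((n + 1 : ℕ) : K) := by push_cast; ring
    have h4 := IsUltrametricDist.norm_add_le_max ((n + 2 : ℕ) : K) (-((n + 1 : ℕ) : K))
    rw [← sub_eq_add_neg, ← h3, norm_one, norm_neg] at h4
    rcases le_max_iff.1 h4 with h5 | h5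
    · exact h5
    · linarith

theorem lemN1 (T : Finset K) (μ : K → ℤ) (a t : K) (ht : t ≠ 0) (B : ℝ) (hB : 0 ≤ B)
    (hT : ∀ x ∈ T, ‖a - x‖ ≠ ‖t‖)
    (h : ∀ w : K, ‖w‖ = ‖t‖ → ‖w * ∑ x ∈ T, (μ x : K) / (a + w - x)‖ ≤ B) :
    ‖((∑ x ∈ T with ‖a - x‖ < ‖t‖, μ x : ℤ) : K)‖ ≤ B := by
  have hlim : Tendsto (fun N : ℕ => ∑ x ∈ T, (μ x : K) * (t ^ N / (t ^ N - (x - a) ^ N))) atTop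
      (nhds ((∑ x ∈ T with ‖a - x‖ < ‖t‖, μ x : ℤ) : K)) := by
    rw [Int.cast_sum, Finset.sum_filter]
    refine tendsto_finsetSum _ fun x hx => ?_
    split_ifs with hlt
    · simpa using (lim_inside t (x - a) ht (by rwa [norm_sub_rev])).const_mul (μ x : K)
    · have : ‖t‖ < ‖x - a‖ := by
        rw [norm_sub_rev]
        exact lt_of_le_of_ne (not_lt.1 hlt) (hT x hx).symm
      simpa using (lim_outside t (x - a) this).const_mul (μ x : K)
  refine le_of_tendsto_of_frequently hlim.norm ?_
  refine freq_norm_one (K := K) |>.mono ?_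
  rintro N ⟨hN0, hN1⟩
  have key : ((X ^ N - C (t ^ N) : K[X]).roots.map
      (fun w => w * ∑ x ∈ T, (μ x : K) / (a + w - x))).sum
      = N * ∑ x ∈ T, (μ x : K) * (t ^ N / (t ^ N - (x - a) ^ N)) := by
    rw [Finset.mul_sum]
    have : ∀ x ∈ T, (N : K) * ((μ x : K) * (t ^ N / (t ^ N - (x - a) ^ N)))
        = ((X ^ N - C (t ^ N) : K[X]).roots.map
          (fun w => (μ x : K) * (w / (w - (x - a))))).sum := by
      intro x hx
      rw [Multiset.sum_map_mul_left, avg_id t (x - a) N hN0]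
      · ring
      · intro he
        apply hT x hx
        have := congrArg norm he
        rw [norm_pow, norm_pow] at this
        rw [norm_sub_rev]
        exact (pow_left_inj₀ (norm_nonneg _) (norm_nonneg _) hN0.ne').1 this
    rw [Finset.sum_congr rfl this, ← Multiset.sum_map_sum]
    refine congrArg Multiset.sum (Multiset.map_congr rfl fun w _ => ?_)
    rw [Finset.mul_sum]
    refine Finset.sum_congr rfl fun x _ => ?_
    rw [show w - (x - a) = a + w - x by ring]
    ring
  have h2 := norm_msum_le _ _ B hB (fun w (hw : w ∈ (X ^ N - C (t ^ N) : K[X]).roots) => h w (by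
    have := isRoot_of_mem_roots hw
    simp only [IsRoot.def, eval_sub, eval_pow, eval_X, eval_C, sub_eq_zero] at this
    have := congrArg norm this
    rw [norm_pow, norm_pow] at this
    exact (pow_left_inj₀ (norm_nonneg _) (norm_nonneg _) hN0.ne').1 this))
  rw [key, norm_mul, hN1, one_mul] at h2
  exact h2

end lemN
section core
variable {K : Type*} [NontriviallyNormedField K] [IsAlgClosed K] [IsUltrametricDist K]

theorem exists_norm_between (u v : ℝ) (hu : 0 < u) (huv : u < v) : ∃ t : K, u < ‖t‖ ∧ ‖t‖ < v := by
  obtain ⟨b, hb⟩ := NormedField.exists_one_lt_norm K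
  have h1 : 1 < v / u := by rwa [one_lt_div hu]
  obtain ⟨n, hn⟩ := pow_unbounded_of_one_lt ‖b‖ h1
  have hn0 : 0 < n := by
    rcases Nat.eq_zero_or_pos n with h | h
    · subst h; simp at hn; linarith
    · exact h
  obtain ⟨q, hq⟩ := IsAlgClosed.exists_pow_nat_eq b hn0
  have hqn : ‖q‖ ^ n = ‖b‖ := by rw [← norm_pow, hq]
  have hq1 : 1 < ‖q‖ := by
    by_contra! h
    have := pow_le_one₀ (norm_nonneg q) h (n := n)
    linarith
  have hq2 : ‖q‖ < v / u := by
    by_contra! h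
    have := pow_le_pow_left₀ (by positivity) h n
    linarith
  obtain ⟨k, hk1, hk2⟩ := exists_mem_Ico_zpow hu hq1
  refine ⟨q ^ (k + 1), by rw [norm_zpow]; exact hk2, ?_⟩
  rw [norm_zpow, zpow_add_one₀ (by positivity)]
  rw [lt_div_iff₀ hu] at hq2
  calc ‖q‖ ^ k * ‖q‖ ≤ u * ‖q‖ := by gcongr
    _ < v := by linarith

open Classical in
noncomputable def SS (T : Finset K) (Cs : Multiset K) : Finset K := T ∪ Cs.toFinset

open Classical in
noncomputable def ww (T : Finset K) (Cs : Multiset K) (x : K) : ℤ :=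
  (Cs.count x : ℤ) - if x ∈ T then 1 else 0

open Classical in
noncomputable def mm (T : Finset K) (μ : K → ℤ) (x : K) : ℤ := if x ∈ T then μ x else 0

theorem prod_mm (T : Finset K) (Cs : Multiset K) (μ : K → ℤ) (F : K → ℝ) :
    ∏ x ∈ SS T Cs, F x ^ (mm T μ x) = ∏ x ∈ T, F x ^ (μ x) := by
  classical
  symm
  rw [← Finset.prod_subset (s₁ := T) (s₂ := SS T Cs) (Finset.subset_union_left)]
  · exact Finset.prod_congr rfl fun x hx => by simp [mm, hx]
  · intro x _ hx
    simp [mm, hx]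

theorem prod_ww (T : Finset K) (Cs : Multiset K) (F : K → ℝ) (hF : ∀ x, 0 < F x) :
    ∏ x ∈ SS T Cs, F x ^ (ww T Cs x) = (Cs.map F).prod / ∏ x ∈ T, F x := by
  classical
  have h1 : ∏ x ∈ T, F x = ∏ x ∈ SS T Cs, F x ^ (if x ∈ T then (1 : ℤ) else 0) := by
    rw [← Finset.prod_subset (s₁ := T) (s₂ := SS T Cs) (Finset.subset_union_left)]
    · exact Finset.prod_congr rfl fun x hx => by simp [hx]
    · intro x _ hx
      simp [hx]
  have h2 : (Cs.map F).prod = ∏ x ∈ SS T Cs, F x ^ ((Cs.count x : ℕ) : ℤ) := by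
    rw [Finset.prod_multiset_map_count]
    rw [← Finset.prod_subset (s₁ := Cs.toFinset) (s₂ := SS T Cs) (Finset.subset_union_right)]
    · exact Finset.prod_congr rfl fun x hx => by rw [zpow_natCast]
    · intro x _ hx
      rw [Multiset.mem_toFinset] at hx
      simp [hx]
  rw [h1, h2, ← Finset.prod_div_distrib]
  refine Finset.prod_congr rfl fun x _ => ?_
  rw [ww, zpow_sub₀ (hF x).ne']

theorem sum_ww (T : Finset K) (Cs : Multiset K) :
    ∑ x ∈ SS T Cs, ww T Cs x = Cs.card - T.card := by
  classical
  unfold ww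
  rw [Finset.sum_sub_distrib]
  congr 1
  · rw [← Nat.cast_sum]
    congr 1
    refine Multiset.sum_count_eq_card ?_
    intro a ha
    exact Finset.mem_union_right _ (Multiset.mem_toFinset.2 ha)
  · rw [Finset.sum_ite_mem, SS, Finset.union_inter_cancel_left]
    simp

theorem norm_mprod (Cs : Multiset K) (z : K) :
    ‖(Cs.map (fun c => z - c)).prod‖ = (Cs.map (fun c => ‖z - c‖)).prod := by
  induction Cs using Multiset.induction_on with
  | empty => simp
  | cons a s ih => simp [ih]

theorem mprod_le (Cs : Multiset K) (F G : K → ℝ) (h0 : ∀ x, 0 ≤ F x) (h : ∀ x, F x ≤ G x) :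
    (Cs.map F).prod ≤ (Cs.map G).prod := by
  induction Cs using Multiset.induction_on with
  | empty => simp
  | cons a s ih =>
    rw [Multiset.map_cons, Multiset.map_cons, Multiset.prod_cons, Multiset.prod_cons]
    refine mul_le_mul (h a) ih ?_ ((h0 a).trans (h a))
    exact Multiset.prod_nonneg (by simpa using fun x _ => h0 x)

theorem norm_shift {a w x : K} (h : ‖a - x‖ ≠ ‖w‖) : ‖a + w - x‖ = max ‖w‖ ‖a - x‖ := by
  rw [show a + w - x = w + (a - x) by ring]
  exact IsUltrametricDist.norm_add_eq_max_of_norm_ne_norm h.symm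

theorem hn_core (T : Finset K) (Cs : Multiset K) (μ : K → ℤ) (C0 : K) (l : ℝ) (d : ℕ)
    (hlK : ∀ k : ℤ, k ≠ 0 → |k| ≤ d → l ≤ ‖(k : K)‖)
    (hb : ∀ U ⊆ T, |∑ x ∈ U, μ x| ≤ d)
    (hid : ∀ z ∉ T, ∑ x ∈ T, (μ x : K) / (z - x)
      = C0 * (Cs.map (fun c => z - c)).prod / ∏ x ∈ T, (z - x)) :
    HN (SS T Cs) (ww T Cs) (mm T μ) ‖C0‖ l := by
  classical
  intro a s₁ s₂ h1 h12 hS hν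
  have hTS : T ⊆ SS T Cs := Finset.subset_union_left
  set E : ℝ → ℝ := fun s => ‖C0‖ * s * MM (SS T Cs) (ww T Cs) a s with hE
  have hsum : ∑ x ∈ SS T Cs with ‖a - x‖ ≤ s₁, mm T μ x = ∑ x ∈ T with ‖a - x‖ ≤ s₁, μ x := by
    rw [Finset.sum_filter, Finset.sum_filter]
    symm
    rw [← Finset.sum_subset (s₁ := T) (s₂ := SS T Cs) hTS]
    · exact Finset.sum_congr rfl fun x hx => by simp [mm, hx]
    · intro x _ hx
      simp [mm, hx]
  rw [hsum] at hν
  have hl := hlK _ hν (hb _ (Finset.filter_subset _ _))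
  have key : ∀ t : K, s₁ < ‖t‖ → ‖t‖ < s₂ → l ≤ E ‖t‖ := by
    intro t ht1 ht2
    have ht : 0 < ‖t‖ := h1.trans ht1
    have hT : ∀ x ∈ T, ‖a - x‖ ≠ ‖t‖ := by
      intro x hx he
      rcases hS x (hTS hx) with h | h <;> linarith
    refine hl.trans ?_
    have hfil : T.filter (fun x => ‖a - x‖ ≤ s₁) = T.filter (fun x => ‖a - x‖ < ‖t‖) := by
      refine Finset.filter_congr fun x hx => ⟨fun h => h.trans_lt ht1, fun h => ?_⟩
      rcases hS x (hTS hx) with h' | h' <;> linarith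
    rw [hfil]
    have hMM : MM (SS T Cs) (ww T Cs) a ‖t‖ = (Cs.map (fun x => max ‖t‖ ‖a - x‖)).prod /
        ∏ x ∈ T, max ‖t‖ ‖a - x‖ :=
      prod_ww T Cs _ (fun x => lt_max_of_lt_left ht)
    refine lemN1 T μ a t (norm_pos_iff.1 ht) _ ?_ hT ?_
    · have := MM_pos (SS T Cs) (ww T Cs) a ht
      positivity
    · intro w hw
      have hne : ∀ x ∈ T, ‖a + w - x‖ = max ‖t‖ ‖a - x‖ := by
        intro x hx
        rw [norm_shift (by rw [hw]; exact hT x hx), hw]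
      have hz : a + w ∉ T := by
        intro hx
        have := hne _ hx
        rw [sub_self, norm_zero] at this
        have := lt_max_of_lt_left (b := ‖t‖) (c := ‖a - (a + w)‖) ht
        linarith
      rw [hid _ hz, norm_mul, norm_div, norm_mul, norm_prod, norm_mprod, hw,
        Finset.prod_congr rfl hne]
      have hpos : 0 < ∏ x ∈ T, max ‖t‖ ‖a - x‖ :=
        Finset.prod_pos fun x _ => lt_max_of_lt_left ht
      have hle := mprod_le Cs (fun c => ‖a + w - c‖) (fun x => max ‖t‖ ‖a - x‖)
        (fun x => norm_nonneg _) (fun x => by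
          have := IsUltrametricDist.norm_add_le_max w (a - x)
          rw [hw, show w + (a - x) = a + w - x by ring] at this
          exact this)
      simp only [hE]
      rw [hMM]
      calc _ = ‖C0‖ * ‖t‖ * ((Cs.map (fun c => ‖a + w - c‖)).prod / ∏ x ∈ T, max ‖t‖ ‖a - x‖) := by
            ring
        _ ≤ _ := by gcongr
  have all : ∀ s, s₁ ≤ s → s ≤ s₂ → l ≤ E s := by
    intro s hs1 hs2
    by_contra! hlt
    have hcont : ContinuousAt E s := by
      have : ContinuousAt (fun s => MM (SS T Cs) (ww T Cs) a s) s := by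
        unfold MM
        refine tendsto_finsetProd _ fun x _ => ?_
        have h0 : 0 < max s ‖a - x‖ := lt_max_of_lt_left (by linarith)
        have : ContinuousAt (fun s => max s ‖a - x‖) s := by fun_prop
        exact this.zpow₀ _ (Or.inl h0.ne')
      exact (continuousAt_const.mul continuousAt_id).mul this
    have hev := hcont.eventually_lt continuousAt_const hlt
    obtain ⟨ε, hε, hball⟩ := Metric.eventually_nhds_iff.1 hev
    obtain ⟨t, ht1, ht2⟩ := exists_norm_between (K := K) (max s₁ (s - ε)) (min s₂ (s + ε))
      (lt_max_of_lt_left h1) (max_lt (lt_min h12 (by linarith)) (lt_min (by linarith) (by linarith)))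
    rw [max_lt_iff] at ht1
    rw [lt_min_iff] at ht2
    have h3 := hball (y := ‖t‖) (by rw [Real.dist_eq, abs_lt]; constructor <;> linarith)
    have h4 := key t ht1.1 ht2.1
    linarith
  exact ⟨all s₁ le_rfl h12.le, all s₂ h12.le le_rfl⟩

end core
section core2
variable {K : Type*} [NontriviallyNormedField K] [IsAlgClosed K] [IsUltrametricDist K]

open Classical in
theorem core_thm (T : Finset K) (μ : K → ℤ) (l : ℝ) (d : ℕ) (hl : 0 < l)
    (hlK : ∀ k : ℤ, k ≠ 0 → |k| ≤ d → l ≤ ‖(k : K)‖)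
    (hb : ∀ U ⊆ T, |∑ x ∈ U, μ x| ≤ d) (hμ : ∀ x ∈ T, μ x ≠ 0) (htot : ∑ x ∈ T, μ x ≠ 0)
    (z0 : K) (hz0 : z0 ∈ T) (hμ1 : μ z0 = 1) (r : ℝ)
    (hr : ∃ x ∈ T, x ≠ z0 ∧ ‖z0 - x‖ = r) (hmin : ∀ x ∈ T, x ≠ z0 → r ≤ ‖z0 - x‖) :
    ∃ c ∉ T, ∑ x ∈ T, (μ x : K) / (c - x) = 0 ∧
      ∏ x ∈ T, ‖c - x‖ ^ (μ x) ≤ (r * ∏ x ∈ T.erase z0, ‖z0 - x‖ ^ (μ x)) / l ^ d := by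
  have hr0 : 0 < r := by
    obtain ⟨x, _, h2, h3⟩ := hr
    rw [← h3]; exact norm_pos_iff.2 (sub_ne_zero.2 h2.symm)
  have hd1 : (1 : ℤ) ≤ d := by
    have := hb {z0} (by simpa using hz0)
    simpa [hμ1] using this
  have hl1 : l ≤ 1 := by simpa using hlK 1 one_ne_zero (by simpa using hd1)
  have hKne : ∀ k : ℤ, k ≠ 0 → |k| ≤ d → (k : K) ≠ 0 := fun k h1 h2 =>
    norm_pos_iff.1 (hl.trans_le (hlK k h1 h2))
  set P : K[X] := ∑ x ∈ T, C (μ x : K) * ∏ y ∈ T.erase x, (X - C y) with hP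
  have hmon : ∀ x ∈ T, (∏ y ∈ T.erase x, (X - C y)).natDegree = T.card - 1 := by
    intro x hx
    rw [natDegree_finsetProd_X_sub_C_eq_card, Finset.card_erase_of_mem hx]
  have hcoeff : P.coeff (T.card - 1) = ((∑ x ∈ T, μ x : ℤ) : K) := by
    rw [hP, finset_sum_coeff, Int.cast_sum]
    refine Finset.sum_congr rfl fun x hx => ?_
    rw [coeff_C_mul]
    have : (∏ y ∈ T.erase x, (X - C y)).Monic := monic_prod_of_monic _ _ fun y _ => monic_X_sub_C y
    have h2 := this.coeff_natDegree
    rw [hmon x hx] at h2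
    rw [h2, mul_one]
  have hcne : P.coeff (T.card - 1) ≠ 0 := by
    rw [hcoeff]; exact hKne _ htot (hb T subset_rfl)
  have hPdeg : P.natDegree = T.card - 1 := by
    refine le_antisymm ?_ (le_natDegree_of_ne_zero hcne)
    refine natDegree_sum_le_of_forall_le _ _ fun x hx => ?_
    exact (natDegree_C_mul_le _ _).trans (hmon x hx).le
  have hP0 : P ≠ 0 := by
    intro h; rw [h] at hcne; simp at hcne
  have hsp : P.Splits := IsAlgClosed.splits P
  have hcard : P.roots.card = T.card - 1 := by rw [← hPdeg]; exact hsp.natDegree_eq_card_roots.symm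
  have hTpos : 0 < T.card := Finset.card_pos.2 ⟨z0, hz0⟩
  have hevT : ∀ x ∈ T, P.eval x = μ x * ∏ y ∈ T.erase x, (x - y) := by
    intro x hx
    rw [hP, eval_finset_sum, Finset.sum_eq_single x]
    · simp [eval_prod]
    · intro b hb hbx
      rw [eval_mul, eval_prod, Finset.prod_eq_zero (i := x)]
      · simp
      · exact Finset.mem_erase.2 ⟨hbx.symm, hx⟩
      · simp
    · intro h; exact absurd hx h
  have hev : ∀ z ∉ T, ∑ x ∈ T, (μ x : K) / (z - x) = P.eval z / ∏ x ∈ T, (z - x) := by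
    intro z hz
    have hne : ∀ x ∈ T, z - x ≠ 0 := by
      intro x hx h
      rw [sub_eq_zero] at h
      exact hz (h ▸ hx)
    rw [hP, eval_finset_sum, Finset.sum_div]
    refine Finset.sum_congr rfl fun x hx => ?_
    rw [eval_mul, eval_C, eval_prod, ← Finset.mul_prod_erase T (fun x => z - x) hx]
    have h1 : ∏ y ∈ T.erase x, (z - y) ≠ 0 :=
      Finset.prod_ne_zero_iff.2 fun y hy => hne y (Finset.mem_of_mem_erase hy)
    have h2 := hne x hx
    simp only [eval_sub, eval_X, eval_C]
    field_simp
  have hroot : ∀ c ∈ P.roots, c ∉ T := by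
    intro c hc hcT
    have h1 : P.eval c = 0 := isRoot_of_mem_roots hc
    rw [hevT c hcT] at h1
    have h2 : (μ c : K) ≠ 0 := hKne _ (hμ c hcT) (by simpa using hb {c} (by simpa using hcT))
    have h3 : ∏ y ∈ T.erase c, (c - y) ≠ 0 :=
      Finset.prod_ne_zero_iff.2 fun y hy => sub_ne_zero.2 (Finset.ne_of_mem_erase hy).symm
    exact mul_ne_zero h2 h3 h1
  have hcrit : ∀ c ∈ P.roots, ∑ x ∈ T, (μ x : K) / (c - x) = 0 := by
    intro c hc
    rw [hev c (hroot c hc), show P.eval c = 0 from isRoot_of_mem_roots hc, zero_div]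
  set R := r * ∏ x ∈ T.erase z0, ‖z0 - x‖ ^ (μ x) with hR
  have hprodpos : 0 < ∏ x ∈ T.erase z0, ‖z0 - x‖ ^ (μ x) :=
    Finset.prod_pos fun x hx => zpow_pos (norm_pos_iff.2 (sub_ne_zero.2
      (Finset.ne_of_mem_erase hx).symm)) _
  have hRpos : 0 < R := by positivity
  have hRR : R ≤ R / l ^ d := by
    rw [le_div_iff₀ (by positivity)]
    have : l ^ d ≤ 1 := pow_le_one₀ hl.le hl1
    nlinarith
  by_cases hclose : ∃ c ∈ P.roots, ‖z0 - c‖ < r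
  · obtain ⟨c, hc, hcr⟩ := hclose
    refine ⟨c, hroot c hc, hcrit c hc, le_trans ?_ hRR⟩
    rw [← Finset.mul_prod_erase T _ hz0, hμ1, zpow_one, hR]
    have : ∀ x ∈ T.erase z0, ‖c - x‖ ^ (μ x) = ‖z0 - x‖ ^ (μ x) := by
      intro x hx
      have h1 := hmin x (Finset.mem_of_mem_erase hx) (Finset.ne_of_mem_erase hx)
      have h2 := max_recenter (x := x) hcr.le
      have h3 : r ≤ ‖c - x‖ := by
        by_contra! h
        have := (lt_recenter hcr).2 h
        linarith
      rw [max_eq_right h1, max_eq_right h3] at h2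
      rw [h2]
    rw [Finset.prod_congr rfl this]
    rw [norm_sub_rev] at hcr
    gcongr
  · push Not at hclose
    have hC0 : P.leadingCoeff ≠ 0 := leadingCoeff_ne_zero.2 hP0
    have hev' : ∀ z, P.eval z = P.leadingCoeff * (P.roots.map (fun c => z - c)).prod :=
      fun z => hsp.eval_eq_prod_roots z
    have hN := hn_core T P.roots μ P.leadingCoeff l d hlK hb (fun z hz => by
      rw [hev z hz, ← hev' z])
    have hTS : T ⊆ SS T P.roots := by unfold SS; exact Finset.subset_union_left
    have hmaxT : ∀ x ∈ T.erase z0, max r ‖z0 - x‖ = ‖z0 - x‖ := fun x hx =>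
      max_eq_right (hmin x (Finset.mem_of_mem_erase hx) (Finset.ne_of_mem_erase hx))
    have hGz : MM (SS T P.roots) (mm T μ) z0 r = R := by
      unfold MM
      rw [prod_mm T P.roots μ (fun x => max r ‖z0 - x‖), ← Finset.mul_prod_erase T _ hz0, hμ1,
        zpow_one, hR, sub_self, norm_zero, max_eq_left hr0.le]
      congr 1
      exact Finset.prod_congr rfl fun x hx => by rw [hmaxT x hx]
    have hEz : ‖P.leadingCoeff‖ * r * MM (SS T P.roots) (ww T P.roots) z0 r = 1 := by
      unfold MM
      rw [prod_ww T P.roots (fun x => max r ‖z0 - x‖) (fun x => lt_max_of_lt_left hr0),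
        ← Finset.mul_prod_erase T _ hz0, sub_self, norm_zero, max_eq_left hr0.le,
        Finset.prod_congr rfl hmaxT,
        Multiset.map_congr rfl (fun c hc => max_eq_right (hclose c hc))]
      have h1 := congrArg norm ((hev' z0).symm.trans (hevT z0 hz0))
      rw [norm_mul, norm_mprod, hμ1, Int.cast_one, one_mul, norm_prod] at h1
      have h2 : ∏ x ∈ T.erase z0, ‖z0 - x‖ ≠ 0 :=
        Finset.prod_ne_zero_iff.2 fun y hy =>
          norm_ne_zero_iff.2 (sub_ne_zero.2 (Finset.ne_of_mem_erase hy).symm)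
      rw [← h1] at h2 ⊢
      have h3 := right_ne_zero_of_mul h2
      have h4 := left_ne_zero_of_mul h2
      field_simp
    have hg : Good (SS T P.roots) (ww T P.roots) (mm T μ) ‖P.leadingCoeff‖ R l d z0 r := by
      refine ⟨hr0, ?_, ?_⟩
      · rw [hGz, hEz]; simp
      · rw [hGz]; exact hRR
    have hbS : ∀ U ⊆ SS T P.roots, |∑ x ∈ U, mm T μ x| ≤ d := by
      intro U _
      have : ∑ x ∈ U, mm T μ x = ∑ x ∈ U.filter (fun x => x ∈ T), μ x := by
        rw [Finset.sum_filter]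
        exact Finset.sum_congr rfl fun x _ => by simp [mm]
      rw [this]
      exact hb _ fun x hx => (Finset.mem_filter.1 hx).2
    have hwT : ∀ x ∈ T, ww T P.roots x = -1 := by
      intro x hx
      have : x ∉ P.roots := fun h => hroot x h hx
      unfold ww
      rw [Multiset.count_eq_zero_of_notMem this, if_pos hx]; simp
    have hwC : ∀ x ∉ T, x ∈ SS T P.roots → x ∈ P.roots := by
      intro x hx h
      unfold SS at h
      rw [Finset.mem_union, Multiset.mem_toFinset] at h
      tauto
    have hww : ∀ x ∈ SS T P.roots,
        (0 < ww T P.roots x ∧ mm T μ x = 0) ∨ ww T P.roots x < 0 := by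
      intro x hx
      by_cases hxT : x ∈ T
      · right; rw [hwT x hxT]; norm_num
      · left
        refine ⟨?_, by simp [mm, hxT]⟩
        unfold ww
        rw [if_neg hxT, sub_zero]
        exact_mod_cast Multiset.count_pos.2 (hwC x hxT hx)
    obtain ⟨c, hc1, hc2, hc3⟩ := walk (SS T P.roots) (ww T P.roots) (mm T μ) ‖P.leadingCoeff‖ R l d
      (norm_pos_iff.2 hC0) hl hbS hN hww (by rw [sum_ww, hcard]; omega) z0 r hg
      (by obtain ⟨x, h1, _, h3⟩ := hr; exact ⟨x, hTS h1, h3⟩)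
      (by
        have : (SS T P.roots).filter (fun x => ‖z0 - x‖ < r) = {z0} := by
          ext x
          rw [Finset.mem_filter, Finset.mem_singleton]
          constructor
          · rintro ⟨h1, h2⟩
            by_contra hne
            by_cases hxT : x ∈ T
            · linarith [hmin x hxT hne]
            · linarith [hclose x (hwC x hxT h1)]
          · rintro rfl
            exact ⟨hTS hz0, by simpa using hr0⟩
        rw [this, Finset.sum_singleton, hwT z0 hz0])
    have hcT : c ∉ T := by
      intro h
      rw [hwT c h] at hc2
      omega
    refine ⟨c, hcT, hcrit c (hwC c hcT hc1), ?_⟩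
    rw [prod_mm T P.roots μ (fun x => ‖c - x‖)] at hc3
    exact hc3

end core2
section final
variable {K : Type*} [NontriviallyNormedField K]

theorem lam_le (d : ℕ) (k : ℤ) (hk : k ≠ 0) (hkd : |k| ≤ d) : lam K d ≤ ‖(k : K)‖ := by
  have h1 : ‖(k : K)‖ = ‖((k.natAbs : ℕ) : K)‖ := by
    rcases Int.natAbs_eq k with h | h
    · conv_lhs => rw [h]
      simp
    · conv_lhs => rw [h]
      simp
  rw [h1]
  have h2 : k.natAbs ∈ Finset.Icc 1 d := by
    rw [Finset.mem_Icc]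
    rw [Int.abs_eq_natAbs] at hkd
    omega
  exact ciInf_le (f := fun m : Finset.Icc 1 d => ‖((m : ℕ) : K)‖)
    ⟨0, by rintro _ ⟨m, rfl⟩; exact norm_nonneg _⟩ ⟨_, h2⟩

open Classical in
theorem sum_count_le (U : Finset K) (s : Multiset K) : ∑ x ∈ U, s.count x ≤ s.card := by
  calc ∑ x ∈ U, s.count x ≤ ∑ x ∈ U ∪ s.toFinset, s.count x :=
        Finset.sum_le_sum_of_subset Finset.subset_union_left
    _ = s.card := Multiset.sum_count_eq_card fun a ha =>
        Finset.mem_union_right _ (Multiset.mem_toFinset.2 ha)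

open Classical in
theorem mprod_count (T : Finset K) (s : Multiset K) (F : K → K) (h : ∀ x ∈ s, x ∈ T) :
    (s.map F).prod = ∏ x ∈ T, F x ^ s.count x := by
  rw [Finset.prod_multiset_map_count]
  refine Finset.prod_subset (fun x hx => h x (Multiset.mem_toFinset.1 hx)) ?_
  intro x _ hx
  rw [Multiset.mem_toFinset] at hx
  simp [hx]

open Classical in
theorem msum_count (T : Finset K) (s : Multiset K) (F : K → K) (h : ∀ x ∈ s, x ∈ T) :
    (s.map F).sum = ∑ x ∈ T, (s.count x : K) * F x := by
  rw [Finset.sum_multiset_map_count]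
  simp only [nsmul_eq_mul]
  refine Finset.sum_subset (fun x hx => h x (Multiset.mem_toFinset.1 hx)) ?_
  intro x _ hx
  rw [Multiset.mem_toFinset] at hx
  simp [hx]

end final

theorem strict_critical_value_location
    {K : Type*} [NontriviallyNormedField K] [IsAlgClosed K]
    [CompleteSpace K] [IsUltrametricDist K]
    (d : ℕ) (hd : 2 ≤ d) (hlam : 0 < lam K d)
    (f g : Polynomial K) (hcop : IsCoprime f g)
    (hdegf : f.natDegree = d) (hdegfg : g.natDegree < f.natDegree)
    (z0 : K) (hz0 : g.eval z0 ≠ 0)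
    (hz0' : (f.derivative * g - f * g.derivative).eval z0 ≠ 0)
    (rb : ℝ)
    (hrb : IsLeast {t : ℝ | ∃ w : K,
      (g.eval w = 0 ∨
        (g.eval w ≠ 0 ∧ f.eval w / g.eval w = f.eval z0 / g.eval z0 ∧ w ≠ z0)) ∧
      t = ‖w - z0‖} rb) :
    ∃ c : K, g.eval c ≠ 0 ∧ (f.derivative * g - f * g.derivative).eval c = 0 ∧
      0 < ‖f.eval c / g.eval c - f.eval z0 / g.eval z0‖ ∧
      ‖f.eval c / g.eval c - f.eval z0 / g.eval z0‖ ≤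
        lam K d ^ (-(d : ℤ)) *
          (‖(f.derivative * g - f * g.derivative).eval z0‖ / ‖g.eval z0‖ ^ 2) * rb := by
  classical
  set q := f.eval z0 / g.eval z0 with hq
  set F : K[X] := f - C q * g with hF
  have hg0 : g ≠ 0 := by rintro rfl; simp at hz0
  have hW : f.derivative * g - f * g.derivative = F.derivative * g - F * g.derivative := by
    rw [hF, derivative_sub, derivative_mul, derivative_C]; ring
  rw [hW] at hz0' ⊢
  have hFdeg : F.natDegree = d := by
    rw [hF, natDegree_sub_eq_left_of_natDegree_lt, hdegf]
    exact (natDegree_C_mul_le _ _).trans_lt hdegfg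
  have hF0 : F ≠ 0 := by
    rintro h; rw [h] at hFdeg; simp at hFdeg; omega
  have hFev : ∀ z, F.eval z = f.eval z - q * g.eval z := fun z => by simp [hF]
  have hFz0 : F.eval z0 = 0 := by rw [hFev, hq]; field_simp; ring
  have hcopF : ∀ z, ¬ (F.eval z = 0 ∧ g.eval z = 0) := by
    rintro z ⟨h1, h2⟩
    obtain ⟨u, v, huv⟩ := hcop
    have h3 := congrArg (eval z) huv
    rw [hFev, h2, mul_zero, sub_zero] at h1
    simp [h1, h2] at h3
  have hQ : ∀ z, g.eval z ≠ 0 → f.eval z / g.eval z - q = F.eval z / g.eval z := by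
    intro z hz
    rw [hFev]; field_simp
  have hWz0 : (F.derivative * g - F * g.derivative).eval z0 = F.derivative.eval z0 * g.eval z0 := by
    simp [hFz0]
  have hF'z0 : F.derivative.eval z0 ≠ 0 := by
    rw [hWz0] at hz0'; exact left_ne_zero_of_mul hz0'
  have hsF : F.Splits := IsAlgClosed.splits F
  have hsg : g.Splits := IsAlgClosed.splits g
  set T : Finset K := F.roots.toFinset ∪ g.roots.toFinset with hT
  have hTmem : ∀ x, x ∈ T ↔ F.eval x = 0 ∨ g.eval x = 0 := by
    intro x
    rw [hT, Finset.mem_union, Multiset.mem_toFinset, Multiset.mem_toFinset, mem_roots hF0,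
      mem_roots hg0]
    rfl
  have hFT : ∀ x ∈ F.roots, x ∈ T := fun x hx => (hTmem x).2 (Or.inl (isRoot_of_mem_roots hx))
  have hgT : ∀ x ∈ g.roots, x ∈ T := fun x hx => (hTmem x).2 (Or.inr (isRoot_of_mem_roots hx))
  have hcardF : F.roots.card = d := by rw [← hFdeg]; exact hsF.natDegree_eq_card_roots.symm
  have hcardg : g.roots.card = g.natDegree := hsg.natDegree_eq_card_roots.symm
  set μ : K → ℤ := fun x => (F.roots.count x : ℤ) - (g.roots.count x : ℤ) with hμ
  have hsumμ : ∀ U : Finset K, ∑ x ∈ U, μ x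
      = ((∑ x ∈ U, F.roots.count x : ℕ) : ℤ) - ((∑ x ∈ U, g.roots.count x : ℕ) : ℤ) := by
    intro U
    rw [hμ, Finset.sum_sub_distrib]; push_cast; rfl
  have hgz0c : g.roots.count z0 = 0 :=
    Multiset.count_eq_zero_of_notMem fun h => hz0 (isRoot_of_mem_roots h)
  have hFz0c : F.roots.count z0 = 1 := by
    have h1 : 0 < F.roots.count z0 := Multiset.count_pos.2 ((mem_roots hF0).2 hFz0)
    have h2 : ¬ 1 < F.roots.count z0 := by
      rw [count_roots, one_lt_rootMultiplicity_iff_isRoot hF0]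
      exact fun h => hF'z0 h.2
    omega
  have hmem : ∀ x, x ∈ T → x ≠ z0 → ‖x - z0‖ ∈ {t : ℝ | ∃ w : K,
      (g.eval w = 0 ∨
        (g.eval w ≠ 0 ∧ f.eval w / g.eval w = q ∧ w ≠ z0)) ∧
      t = ‖w - z0‖} := by
    intro x hx hne
    refine ⟨x, ?_, rfl⟩
    by_cases hgx : g.eval x = 0
    · exact Or.inl hgx
    · refine Or.inr ⟨hgx, ?_, hne⟩
      have h1 : F.eval x = 0 := ((hTmem x).1 hx).resolve_right hgx
      have := hQ x hgx
      rw [h1, zero_div, sub_eq_zero] at this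
      exact this
  obtain ⟨c, hcT, hc1, hc2⟩ := core_thm T μ (lam K d) d hlam (lam_le d)
    (by
      intro U _
      rw [hsumμ]
      have h1 := sum_count_le U F.roots
      have h2 := sum_count_le U g.roots
      rw [abs_le]
      constructor <;> omega)
    (by
      intro x hx h
      simp only [hμ] at h
      rcases (hTmem x).1 hx with h1 | h1
      · have h2 : 0 < F.roots.count x := Multiset.count_pos.2 ((mem_roots hF0).2 h1)
        have h3 : g.roots.count x = 0 :=
          Multiset.count_eq_zero_of_notMem fun h => hcopF x ⟨h1, isRoot_of_mem_roots h⟩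
        omega
      · have h2 : 0 < g.roots.count x := Multiset.count_pos.2 ((mem_roots hg0).2 h1)
        have h3 : F.roots.count x = 0 :=
          Multiset.count_eq_zero_of_notMem fun h => hcopF x ⟨isRoot_of_mem_roots h, h1⟩
        omega)
    (by
      rw [hsumμ, Multiset.sum_count_eq_card hFT, Multiset.sum_count_eq_card hgT]
      omega)
    z0 ((hTmem z0).2 (Or.inl hFz0)) (by simp only [hμ]; rw [hgz0c, hFz0c]; norm_num) rb
    (by
      obtain ⟨w, hw1, hw2⟩ := hrb.1
      refine ⟨w, ?_, ?_, by rw [hw2, norm_sub_rev]⟩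
      · rcases hw1 with h | ⟨h1, h2, _⟩
        · exact (hTmem w).2 (Or.inr h)
        · refine (hTmem w).2 (Or.inl ?_)
          have := hQ w h1
          rw [h2, sub_self, eq_comm, div_eq_zero_iff] at this
          exact this.resolve_right h1
      · rcases hw1 with h | ⟨_, _, h⟩
        · rintro rfl; exact hz0 h
        · exact h)
    (by
      intro x hx hne
      rw [norm_sub_rev]
      exact hrb.2 (hmem x hx hne))
  have hFc : F.eval c ≠ 0 := fun h => hcT ((hTmem c).2 (Or.inl h))
  have hgc : g.eval c ≠ 0 := fun h => hcT ((hTmem c).2 (Or.inr h))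
  refine ⟨c, hgc, ?_, ?_, ?_⟩
  · have h1 := hsF.eval_derivative_eq_eval_mul_sum hFc
    have h2 := hsg.eval_derivative_eq_eval_mul_sum hgc
    rw [msum_count T _ _ hFT] at h1
    rw [msum_count T _ _ hgT] at h2
    have h3 : ∑ x ∈ T, (μ x : K) / (c - x) = ∑ x ∈ T, (F.roots.count x : K) * (1 / (c - x))
        - ∑ x ∈ T, (g.roots.count x : K) * (1 / (c - x)) := by
      rw [← Finset.sum_sub_distrib]
      refine Finset.sum_congr rfl fun x _ => ?_
      simp only [hμ]; push_cast; ring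
    rw [eval_sub, eval_mul, eval_mul, h1, h2]
    rw [h3] at hc1
    linear_combination (F.eval c * g.eval c) * hc1
  · rw [hQ c hgc]
    exact norm_pos_iff.2 (div_ne_zero hFc hgc)
  · rw [hQ c hgc, hWz0]
    have hlF : F.leadingCoeff ≠ 0 := leadingCoeff_ne_zero.2 hF0
    have hlg : g.leadingCoeff ≠ 0 := leadingCoeff_ne_zero.2 hg0
    set κ := ‖F.leadingCoeff / g.leadingCoeff‖ with hκ
    have e1 : ‖F.eval c / g.eval c‖ = κ * ∏ x ∈ T, ‖c - x‖ ^ (μ x) := by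
      rw [hsF.eval_eq_prod_roots, hsg.eval_eq_prod_roots, mprod_count T _ _ hFT,
        mprod_count T _ _ hgT, mul_div_mul_comm, ← Finset.prod_div_distrib, norm_mul, norm_prod]
      congr 1
      refine Finset.prod_congr rfl fun x hx => ?_
      have hne : ‖c - x‖ ≠ 0 := norm_ne_zero_iff.2 (sub_ne_zero.2 fun h => hcT (h ▸ hx))
      rw [norm_div, norm_pow, norm_pow, hμ]
      simp only
      rw [zpow_sub₀ hne, zpow_natCast, zpow_natCast]
    have e2 : ‖F.derivative.eval z0‖ / ‖g.eval z0‖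
        = κ * ∏ x ∈ T.erase z0, ‖z0 - x‖ ^ (μ x) := by
      have hd1 : F.derivative.eval z0
          = F.leadingCoeff * ((F.roots.erase z0).map (fun x => z0 - x)).prod := by
        have h5 : z0 ∈ F.roots := (mem_roots hF0).2 hFz0
        conv_lhs => rw [hsF.eq_prod_roots]
        rw [derivative_C_mul, eval_C_mul, eval_multiset_prod_X_sub_C_derivative h5]
      have hm1 : ∀ x ∈ F.roots.erase z0, x ∈ T.erase z0 := by
        intro x hx
        refine Finset.mem_erase.2 ⟨?_, hFT x (Multiset.mem_of_mem_erase hx)⟩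
        rintro rfl
        have := Multiset.count_pos.2 hx
        rw [Multiset.count_erase_self, hFz0c] at this
        omega
      have hm2 : ∀ x ∈ g.roots, x ∈ T.erase z0 := by
        intro x hx
        refine Finset.mem_erase.2 ⟨?_, hgT x hx⟩
        rintro rfl
        exact hz0 (isRoot_of_mem_roots hx)
      rw [← norm_div, hd1, hsg.eval_eq_prod_roots, mprod_count _ _ _ hm1,
        mprod_count _ _ _ hm2, mul_div_mul_comm, ← Finset.prod_div_distrib, norm_mul, norm_prod]
      congr 1
      refine Finset.prod_congr rfl fun x hx => ?_
      have hxz := Finset.ne_of_mem_erase hx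
      have hne : ‖z0 - x‖ ≠ 0 := norm_ne_zero_iff.2 (sub_ne_zero.2 hxz.symm)
      rw [norm_div, norm_pow, norm_pow, hμ, Multiset.count_erase_of_ne hxz]
      simp only
      rw [zpow_sub₀ hne, zpow_natCast, zpow_natCast]
    have e3 : ‖F.derivative.eval z0 * g.eval z0‖ / ‖g.eval z0‖ ^ 2
        = ‖F.derivative.eval z0‖ / ‖g.eval z0‖ := by
      have : ‖g.eval z0‖ ≠ 0 := norm_ne_zero_iff.2 hz0
      rw [norm_mul]
      field_simp
    rw [e1, e3, e2]
    have hκ0 : 0 ≤ κ := norm_nonneg _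
    calc κ * ∏ x ∈ T, ‖c - x‖ ^ (μ x)
        ≤ κ * ((rb * ∏ x ∈ T.erase z0, ‖z0 - x‖ ^ (μ x)) / lam K d ^ d) := by
          refine mul_le_mul_of_nonneg_left ?_ hκ0
          convert hc2
      _ = _ := by
          rw [zpow_neg, zpow_natCast]; ring
end

section
/- (Lemma 2.2, polynomial form) Let P be a nonconstant polynomial with coefficients in K, let r, r' be positive real numbers, and let d ≥ 1 be an integer such that: (i) |P(z)| < r' for every z ∈ K with |z| < r; and (ii) for every w ∈ K with |w| < r', the roots of the polynomial P − w of absolute value < r, counted with multiplicity, are exactly d in number (i.e., P maps {z : |z| < r} onto {w : |w| < r'} with degree d). If |P'(0)| < |d|·r'/r, then P' has a root c ∈ K with |c| < r. -/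
open Polynomial Filter

lemma aux_dense {K : Type*} [NontriviallyNormedField K] [IsAlgClosed K]
    (s t : ℝ) (hs : 0 < s) (hst : s < t) : ∃ w : K, s < ‖w‖ ∧ ‖w‖ < t := by
  obtain ⟨x, hx⟩ := NormedField.exists_one_lt_norm K
  have h1 : 1 < t / s := by rwa [one_lt_div hs]
  obtain ⟨n, hn⟩ := pow_unbounded_of_one_lt ‖x‖ h1
  have hn0 : n ≠ 0 := by
    rintro rfl
    simp at hn
    linarith
  obtain ⟨y, hy⟩ := IsAlgClosed.exists_pow_nat_eq x (Nat.pos_of_ne_zero hn0)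
  have hy' : ‖y‖ ^ n = ‖x‖ := by rw [← norm_pow, hy]
  have hy1 : 1 < ‖y‖ := by
    by_contra h
    have := pow_le_one₀ (n := n) (norm_nonneg y) (not_lt.1 h)
    linarith
  have hy2 : ‖y‖ < t / s := by
    rw [← hy'] at hn
    exact lt_of_pow_lt_pow_left₀ n (by positivity) hn
  obtain ⟨m, hm1, hm2⟩ := exists_mem_Ico_zpow hs hy1
  refine ⟨y ^ (m + 1), by rwa [norm_zpow], ?_⟩
  rw [norm_zpow, zpow_add₀ (by positivity), zpow_one]
  rw [lt_div_iff₀ hs] at hy2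
  have : ‖y‖ ^ m * ‖y‖ ≤ s * ‖y‖ := by gcongr
  linarith

lemma aux_sub {K : Type*} [NontriviallyNormedField K] [IsUltrametricDist K] (a b : K) :
    ‖a - b‖ ≤ max ‖a‖ ‖b‖ := by
  have := IsUltrametricDist.norm_add_le_max a (-b)
  rwa [norm_neg, ← sub_eq_add_neg] at this

def AuxDom {K : Type*} [NontriviallyNormedField K] (r : ℝ) (H : Polynomial K) (d : ℕ) : Prop :=
  0 < ‖H.coeff d‖ ∧ (∀ i, ‖H.coeff i‖ * r ^ i ≤ ‖H.coeff d‖ * r ^ d) ∧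
    ∀ i < d, ‖H.coeff i‖ * r ^ i < ‖H.coeff d‖ * r ^ d

lemma aux_in {K : Type*} [NontriviallyNormedField K] [IsUltrametricDist K]
    (r : ℝ) (hr : 0 < r) (H : Polynomial K) (d : ℕ) (h : AuxDom r H d) (z : K) (hz : ‖z‖ < r) :
    AuxDom r ((X - C z) * H) (d + 1) := by
  obtain ⟨h0, h1, h2⟩ := h
  set M := ‖H.coeff d‖ * r ^ d with hM
  have hMpos : 0 < M := by positivity
  have hb : ∀ i, ‖z * H.coeff i‖ * r ^ i < M * r := by
    intro i
    rw [norm_mul]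
    have := mul_le_mul_of_nonneg_left (h1 i) (norm_nonneg z)
    nlinarith
  have hc : ∀ i, ((X - C z) * H).coeff (i + 1) = H.coeff i - z * H.coeff (i + 1) := by
    intro i; simp [sub_mul]
  have hc0 : ((X - C z) * H).coeff 0 = - (z * H.coeff 0) := by
    simp [sub_mul]
  have hlt : ‖z * H.coeff (d + 1)‖ < ‖H.coeff d‖ := by
    have := hb (d + 1)
    have h3 : M * r = ‖H.coeff d‖ * r ^ (d + 1) := by rw [hM]; ring
    rw [h3] at this
    exact lt_of_mul_lt_mul_right this (by positivity)
  have hd : ‖((X - C z) * H).coeff (d + 1)‖ = ‖H.coeff d‖ := by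
    rw [hc]
    have h4 := aux_sub (H.coeff d - z * H.coeff (d + 1)) (- (z * H.coeff (d + 1)))
    have h5 := aux_sub (H.coeff d) (z * H.coeff (d + 1))
    rw [max_eq_left hlt.le] at h5
    rw [sub_neg_eq_add, sub_add_cancel, norm_neg] at h4
    rcases le_max_iff.1 h4 with h | h
    · exact le_antisymm h5 h
    · linarith
  have hE : ‖H.coeff d‖ * r ^ (d + 1) = M * r := by rw [hM]; ring
  refine ⟨by rwa [hd], ?_, ?_⟩
  · intro i
    rw [hd, hE]
    rcases i with _ | i
    · rw [hc0, norm_neg]; exact (hb 0).le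
    · rw [hc]
      rcases le_max_iff.1 (aux_sub (H.coeff i) (z * H.coeff (i + 1))) with h | h
      · calc _ ≤ ‖H.coeff i‖ * r ^ (i + 1) := by gcongr
          _ = (‖H.coeff i‖ * r ^ i) * r := by ring
          _ ≤ _ := by gcongr; exact h1 i
      · exact le_trans (by gcongr) (hb (i + 1)).le
  · intro i hi
    rw [hd, hE]
    rcases i with _ | i
    · rw [hc0, norm_neg]; exact hb 0
    · rw [hc]
      rcases le_max_iff.1 (aux_sub (H.coeff i) (z * H.coeff (i + 1))) with h | h
      · calc _ ≤ ‖H.coeff i‖ * r ^ (i + 1) := by gcongr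
          _ = (‖H.coeff i‖ * r ^ i) * r := by ring
          _ < _ := by gcongr; exact h2 i (by omega)
      · exact lt_of_le_of_lt (by gcongr) (hb (i + 1))

lemma aux_out {K : Type*} [NontriviallyNormedField K] [IsUltrametricDist K]
    (r : ℝ) (hr : 0 < r) (H : Polynomial K) (d : ℕ) (h : AuxDom r H d) (z : K) (hz : r ≤ ‖z‖) :
    AuxDom r ((X - C z) * H) d := by
  obtain ⟨h0, h1, h2⟩ := h
  set M := ‖H.coeff d‖ * r ^ d with hM
  have hMpos : 0 < M := by positivity
  have hz0 : 0 < ‖z‖ := by linarith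
  have hc : ∀ i, ((X - C z) * H).coeff (i + 1) = H.coeff i - z * H.coeff (i + 1) := by
    intro i; simp [sub_mul]
  have hc0 : ((X - C z) * H).coeff 0 = - (z * H.coeff 0) := by
    simp [sub_mul]
  have hd : ‖((X - C z) * H).coeff d‖ = ‖z‖ * ‖H.coeff d‖ := by
    rcases d with _ | d
    · rw [hc0, norm_neg, norm_mul]
    rw [hc, ← norm_mul]
    have hlt : ‖H.coeff d‖ < ‖z * H.coeff (d + 1)‖ := by
      have h3 := h2 d (by omega)
      rw [hM, pow_succ, mul_comm (r ^ d), ← mul_assoc] at h3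
      have h4 := lt_of_mul_lt_mul_right h3 (by positivity)
      rw [norm_mul]
      nlinarith
    have h4 := aux_sub (H.coeff d) (H.coeff d - z * H.coeff (d + 1))
    have h5 := aux_sub (H.coeff d) (z * H.coeff (d + 1))
    rw [max_eq_right hlt.le] at h5
    rw [sub_sub_cancel] at h4
    rcases le_max_iff.1 h4 with h | h
    · linarith
    · exact le_antisymm h5 h
  have hE : ‖z‖ * ‖H.coeff d‖ * r ^ d = ‖z‖ * M := by rw [hM]; ring
  refine ⟨by rw [hd]; positivity, ?_, ?_⟩
  · intro i
    rw [hd, hE]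
    have hb : ‖z * H.coeff i‖ * r ^ i ≤ ‖z‖ * M := by
      rw [norm_mul, mul_assoc]; gcongr; exact h1 i
    rcases i with _ | i
    · rw [hc0, norm_neg]; exact hb
    · rw [hc]
      rcases le_max_iff.1 (aux_sub (H.coeff i) (z * H.coeff (i + 1))) with h | h
      · calc _ ≤ ‖H.coeff i‖ * r ^ (i + 1) := by gcongr
          _ = r * (‖H.coeff i‖ * r ^ i) := by ring
          _ ≤ _ := by gcongr; exact h1 i
      · exact le_trans (by gcongr) hb
  · intro i hi
    rw [hd, hE]
    have hb : ‖z * H.coeff i‖ * r ^ i < ‖z‖ * M := by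
      rw [norm_mul, mul_assoc]; gcongr; exact h2 i hi
    rcases i with _ | i
    · rw [hc0, norm_neg]; exact hb
    · rw [hc]
      rcases le_max_iff.1 (aux_sub (H.coeff i) (z * H.coeff (i + 1))) with h | h
      · calc _ ≤ ‖H.coeff i‖ * r ^ (i + 1) := by gcongr
          _ = r * (‖H.coeff i‖ * r ^ i) := by ring
          _ < r * M := by gcongr; exact h2 i (by omega)
          _ ≤ _ := by gcongr
      · exact lt_of_le_of_lt (by gcongr) hb

open scoped Classical in
lemma aux_prod {K : Type*} [NontriviallyNormedField K] [IsUltrametricDist K]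
    (r : ℝ) (hr : 0 < r) (s : Multiset K) (c : K) (hc : c ≠ 0) :
    AuxDom r ((s.map (fun a => X - C a)).prod * C c)
      (Multiset.filter (fun z => ‖z‖ < r) s).card := by
  induction s using Multiset.induction_on with
  | empty =>
    refine ⟨by simpa using hc, ?_, by simp⟩
    intro i
    rcases i with _ | i
    · simp
    · simp [coeff_C]
  | cons a s ih =>
    rw [Multiset.map_cons, Multiset.prod_cons, mul_assoc]
    by_cases ha : ‖a‖ < r
    · rw [Multiset.filter_cons_of_pos (p := fun z : K => ‖z‖ < r) s ha, Multiset.card_cons]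
      exact aux_in r hr _ _ ih a ha
    · rw [Multiset.filter_cons_of_neg (p := fun z : K => ‖z‖ < r) s ha]
      exact aux_out r hr _ _ ih a (not_lt.1 ha)

open scoped Classical in
lemma aux_poly {K : Type*} [NontriviallyNormedField K] [IsAlgClosed K] [IsUltrametricDist K]
    (r : ℝ) (hr : 0 < r) (Q : Polynomial K) (hQ : Q ≠ 0) :
    AuxDom r Q (Multiset.filter (fun z => ‖z‖ < r) Q.roots).card := by
  have h := aux_prod r hr Q.roots Q.leadingCoeff (leadingCoeff_ne_zero.2 hQ)
  rwa [mul_comm, ← (IsAlgClosed.splits Q).eq_prod_roots] at h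

open scoped Classical in
theorem critical_point_in_disk
    {K : Type*} [NontriviallyNormedField K] [IsAlgClosed K]
    [CompleteSpace K] [IsUltrametricDist K]
    (P : Polynomial K) (hP : 0 < P.natDegree)
    (r r' : ℝ) (hr : 0 < r) (hr' : 0 < r')
    (d : ℕ) (hd : 1 ≤ d)
    (hmap : ∀ z : K, ‖z‖ < r → ‖P.eval z‖ < r')
    (hfiber : ∀ w : K, ‖w‖ < r' →
      (Multiset.filter (fun z => ‖z‖ < r) (P - Polynomial.C w).roots).card = d)
    (hlt : ‖P.derivative.eval 0‖ < ‖(d : K)‖ * r' / r) :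
    ∃ c : K, ‖c‖ < r ∧ P.derivative.eval c = 0 := by
  have key : r' ≤ ‖P.coeff d‖ * r ^ d := by
    by_contra hcon
    have hP0 : ‖P.coeff 0‖ < r' := by
      rw [coeff_zero_eq_eval_zero]; exact hmap 0 (by simpa using hr)
    have hlt2 : max (r' / 2) (max ‖P.coeff 0‖ (‖P.coeff d‖ * r ^ d)) < r' :=
      max_lt (by linarith) (max_lt hP0 (not_le.1 hcon))
    obtain ⟨w, hw1, hw2⟩ := aux_dense (K := K) _ r' (lt_max_of_lt_left (by linarith)) hlt2
    obtain ⟨-, hw1⟩ := max_lt_iff.1 hw1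
    obtain ⟨hw3, hw4⟩ := max_lt_iff.1 hw1
    have hne : P - C w ≠ 0 := by
      intro h
      rw [sub_eq_zero.1 h, natDegree_C] at hP
      omega
    have h := aux_poly r hr _ hne
    rw [hfiber w hw2] at h
    have h3 := h.2.2 0 (by omega)
    have e1 : (P - C w).coeff d = P.coeff d := by
      rw [coeff_sub, coeff_C_of_ne_zero (by omega), sub_zero]
    rw [e1, coeff_sub, coeff_C_zero, pow_zero, mul_one] at h3
    have h4 := aux_sub (P.coeff 0) (P.coeff 0 - w)
    rw [sub_sub_cancel] at h4
    rcases le_max_iff.1 h4 with h | h <;> linarith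
  by_contra! hno
  have hD : P.derivative ≠ 0 := by
    intro h
    exact hno 0 (by simpa using hr) (by simp [h])
  have h := aux_poly r hr _ hD
  have e : Multiset.filter (fun z => ‖z‖ < r) P.derivative.roots = 0 := by
    rw [Multiset.filter_eq_nil]
    intro a ha hlt
    exact hno a hlt ((mem_roots hD).1 ha)
  rw [e, Multiset.card_zero] at h
  have h2 := h.2.1 (d - 1)
  have e2 : P.derivative.coeff (d - 1) = P.coeff d * d := by
    rw [coeff_derivative, Nat.sub_add_cancel hd]
    congr 1
    rw [← Nat.cast_add_one, Nat.sub_add_cancel hd]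
  rw [e2, coeff_zero_eq_eval_zero, norm_mul, pow_zero, mul_one] at h2
  rw [lt_div_iff₀ hr] at hlt
  have e3 : r ^ d = r ^ (d - 1) * r := by rw [← pow_succ, Nat.sub_add_cancel hd]
  rw [e3] at key
  have h5 := mul_le_mul_of_nonneg_left key (norm_nonneg (d : K))
  have h6 := mul_le_mul_of_nonneg_right h2 hr.le
  nlinarith
end

section
/- (Lemma 4.5, polynomial form) Let P be a nonconstant polynomial with coefficients in K and let r > 0 be such that P' has no root of absolute value strictly less than r. Let d ≥ 1 be an integer such that for every u ∈ K with |u| < r, the set {z ∈ K : |z| < r and P(z) = P(u)} has exactly d elements (the degree of P on the disk {|z| < r}; fibers are simple since there are no critical points). Then: (i) if |d| = 1, the map P is injective on {z ∈ K : |z| < r}; and (ii) if 0 < |d| < 1 (which forces K to have characteristic 0 and the residue characteristic p, the smallest integer m ≥ 2 with |m| < 1, to satisfy 0 < |p| < 1), then P is injective on {z ∈ K : |z| < |p|^{1/(p−1)}·r}. -/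
/-!
STATEMENT 10 (Lemma 4.5, polynomial form): Let `P` be a nonconstant polynomial over `K`
and `r > 0` such that `P'` has no root of norm `< r`.  Let `d ≥ 1` be such that for
every `u` with `‖u‖ < r`, the set `{z : ‖z‖ < r, P z = P u}` has exactly `d` elements.
Then `P` is injective on `{‖z‖ < r}` if `‖(d : K)‖ = 1`, and injective on
`{‖z‖ < ‖p‖^(1/(p−1)) · r}` if `0 < ‖(d : K)‖ < 1`, where `p = resChar K` is the
residue characteristic of `K`.
-/

open Polynomial

/-- The residue characteristic of `K`: the smallest integer `m ≥ 2` with `‖(m : K)‖ < 1`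
(equal to `0 = sInf ∅` if no such integer exists). -/
noncomputable def resChar (K : Type*) [NormedField K] : ℕ :=
  sInf {m : ℕ | 2 ≤ m ∧ ‖(m : K)‖ < 1}

lemma aux_out_s10 {K : Type*} [NontriviallyNormedField K] [IsUltrametricDist K]
    (r : ℝ) (hr : 0 < r) (s : Multiset K) :
    (∀ a ∈ s, r ≤ ‖a‖) → ∀ k, ‖((s.map (fun a => X - C a)).prod).coeff k‖ * r ^ k
      ≤ ‖((s.map (fun a => X - C a)).prod).coeff 0‖ := by
  induction s using Multiset.induction_on with
  | empty =>
    intro _ k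
    rcases k with _ | k
    · simp
    · simp [coeff_one]
  | cons a s ih =>
    intro h k
    have ih := ih (fun b hb => h b (Multiset.mem_cons_of_mem hb))
    have ha := h a (Multiset.mem_cons_self a s)
    rw [Multiset.map_cons, Multiset.prod_cons]
    set p := (s.map (fun a => X - C a)).prod
    have h0 : ((X - C a) * p).coeff 0 = - (a * p.coeff 0) := by
      simp [sub_mul]
    rcases k with _ | k
    · simp
    · have h1 : ((X - C a) * p).coeff (k+1) = p.coeff k - a * p.coeff (k+1) := by
        simp [sub_mul, coeff_X_mul]
      rw [h0, h1, norm_neg, norm_mul]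
      have h2 : ‖p.coeff k - a * p.coeff (k+1)‖ ≤ max ‖p.coeff k‖ ‖a * p.coeff (k+1)‖ := by
        rw [sub_eq_add_neg, ← norm_neg (a * _)]
        exact IsUltrametricDist.norm_add_le_max _ _
      have h3 : ‖p.coeff k‖ * r ^ (k+1) ≤ ‖a‖ * ‖p.coeff 0‖ := by
        calc ‖p.coeff k‖ * r ^ (k+1) = r * (‖p.coeff k‖ * r ^ k) := by ring
          _ ≤ _ := mul_le_mul ha (ih k) (by positivity) (norm_nonneg _)
      have h4 : ‖a * p.coeff (k+1)‖ * r ^ (k+1) ≤ ‖a‖ * ‖p.coeff 0‖ := by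
        rw [norm_mul, mul_assoc]
        exact mul_le_mul_of_nonneg_left (ih _) (norm_nonneg _)
      rcases le_max_iff.1 h2 with h | h
      · exact (mul_le_mul_of_nonneg_right h (by positivity)).trans h3
      · exact (mul_le_mul_of_nonneg_right h (by positivity)).trans h4

lemma aux_in_s10 {K : Type*} [NontriviallyNormedField K] [IsUltrametricDist K]
    (r : ℝ) (hr : 0 < r) (s : Multiset K) :
    (∀ a ∈ s, ‖a‖ < r) → ∀ k < Multiset.card s,
      ‖((s.map (fun a => X - C a)).prod).coeff k‖ * r ^ k < r ^ (Multiset.card s) := by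
  induction s using Multiset.induction_on with
  | empty => intro _ k hk; simp at hk
  | cons a s ih =>
    intro h k hk
    have ih := ih (fun b hb => h b (Multiset.mem_cons_of_mem hb))
    have ha := h a (Multiset.mem_cons_self a s)
    have hc : ((s.map (fun a => X - C a)).prod).coeff (Multiset.card s) = 1 := by
      have hm := monic_multiset_prod_of_monic s (fun a => X - C a) (fun a _ => monic_X_sub_C a)
      have := hm.coeff_natDegree
      rwa [natDegree_multiset_prod_X_sub_C_eq_card] at this
    rw [Multiset.map_cons, Multiset.prod_cons]
    rw [Multiset.card_cons] at hk ⊢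
    set p := (s.map (fun a => X - C a)).prod
    set n := Multiset.card s
    have ihle : ∀ k ≤ n, ‖p.coeff k‖ * r ^ k ≤ r ^ n := by
      intro k hk
      rcases hk.lt_or_eq with h | h
      · exact (ih k h).le
      · rw [h, hc]; simp
    have key : ∀ k ≤ n, ‖a * p.coeff k‖ * r ^ k < r ^ (n+1) := by
      intro k hk
      rw [norm_mul, mul_assoc, pow_succ']
      calc _ ≤ ‖a‖ * r ^ n := mul_le_mul_of_nonneg_left (ihle k hk) (norm_nonneg _)
        _ < _ := mul_lt_mul_of_pos_right ha (by positivity)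
    have h0 : ((X - C a) * p).coeff 0 = - (a * p.coeff 0) := by
      simp [sub_mul]
    rcases k with _ | k
    · rw [h0, norm_neg]; exact key 0 (by omega)
    · have h1 : ((X - C a) * p).coeff (k+1) = p.coeff k - a * p.coeff (k+1) := by
        simp [sub_mul, coeff_X_mul]
      rw [h1]
      have h2 : ‖p.coeff k - a * p.coeff (k+1)‖ ≤ max ‖p.coeff k‖ ‖a * p.coeff (k+1)‖ := by
        rw [sub_eq_add_neg, ← norm_neg (a * _)]
        exact IsUltrametricDist.norm_add_le_max _ _
      have h3 : ‖p.coeff k‖ * r ^ (k+1) < r ^ (n+1) := by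
        calc ‖p.coeff k‖ * r ^ (k+1) = (‖p.coeff k‖ * r ^ k) * r := by ring
          _ < r ^ n * r := mul_lt_mul_of_pos_right (ih k (by omega)) hr
          _ = _ := by ring
      rcases le_max_iff.1 h2 with h | h
      · exact (mul_le_mul_of_nonneg_right h (by positivity)).trans_lt h3
      · exact (mul_le_mul_of_nonneg_right h (by positivity)).trans_lt (key (k+1) (by omega))

lemma aux_eq {K : Type*} [Field K] [IsAlgClosed K] (Q : K[X]) :
    Q = C Q.leadingCoeff * (Q.roots.map (fun a => X - C a)).prod :=
  (IsAlgClosed.splits Q).eq_prod_roots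

lemma aux_der {K : Type*} [NontriviallyNormedField K] [IsUltrametricDist K] [IsAlgClosed K]
    (r : ℝ) (hr : 0 < r) (Q : K[X]) (h0 : Q.derivative ≠ 0)
    (h : ∀ c : K, Q.derivative.eval c = 0 → r ≤ ‖c‖) (k : ℕ) :
    ‖((k+1 : ℕ) : K)‖ * ‖Q.coeff (k+1)‖ * r ^ k ≤ ‖Q.coeff 1‖ := by
  have := aux_out_s10 r hr Q.derivative.roots (fun a ha => h a (isRoot_of_mem_roots ha)) k
  have e := aux_eq Q.derivative
  set p := (Q.derivative.roots.map (fun a => X - C a)).prod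
  have e1 : ∀ j, Q.derivative.coeff j = Q.derivative.leadingCoeff * p.coeff j := by
    intro j
    conv_lhs => rw [e]
    rw [coeff_C_mul]
  have e2 : Q.coeff 1 = Q.derivative.coeff 0 := by simp [coeff_derivative]
  have e3 : ((k+1 : ℕ) : K) * Q.coeff (k+1) = Q.derivative.coeff k := by
    rw [coeff_derivative]; push_cast; ring
  rw [← norm_mul, e3, e2, e1, e1, norm_mul, norm_mul, mul_assoc]
  exact mul_le_mul_of_nonneg_left this (norm_nonneg _)

lemma aux_d {K : Type*} [NontriviallyNormedField K] [IsUltrametricDist K] [IsAlgClosed K]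
    (r : ℝ) (hr : 0 < r) (Q : K[X]) (h0 : Q ≠ 0) (hQ0 : Q.coeff 0 = 0)
    (h : ∀ c : K, Q.derivative.eval c = 0 → r ≤ ‖c‖) (d : ℕ) (hd : 2 ≤ d)
    (hdc : {z : K | ‖z‖ < r ∧ Q.eval z = 0}.ncard = d) :
    ‖Q.coeff 1‖ * r < ‖Q.coeff d‖ * r ^ d := by
  classical
  set s := Q.roots.filter (fun a => ‖a‖ < r)
  set t := Q.roots.filter (fun a => ¬ ‖a‖ < r)
  have hst : s + t = Q.roots := Multiset.filter_add_not _ _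
  have hs : ∀ a ∈ s, ‖a‖ < r := fun a ha => (Multiset.mem_filter.1 ha).2
  have ht : ∀ a ∈ t, r ≤ ‖a‖ := fun a ha => not_lt.1 (Multiset.mem_filter.1 ha).2
  have hnd : s.Nodup := by
    rw [Multiset.nodup_iff_count_le_one]
    intro a
    by_cases ha : a ∈ s
    · refine (Multiset.count_le_of_le a (Multiset.filter_le _ _)).trans ?_
      rw [count_roots]
      by_contra hcon
      push Not at hcon
      have := (one_lt_rootMultiplicity_iff_isRoot h0).1 hcon
      exact absurd (hs a ha) (not_lt.2 (h a this.2))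
    · rw [Multiset.count_eq_zero_of_notMem ha]; omega
  have hcard : Multiset.card s = d := by
    rw [← hdc, ← Multiset.toFinset_card_of_nodup hnd, ← Set.ncard_coe_finset]
    congr 1
    ext z
    simp [s, h0, and_comm]
  have hA := aux_in_s10 r hr s hs
  have hB := aux_out_s10 r hr t ht
  have e := aux_eq Q
  rw [← hst, Multiset.map_add, Multiset.prod_add] at e
  have hc : ((s.map (fun a => X - C a)).prod).coeff (Multiset.card s) = 1 := by
    have hm := monic_multiset_prod_of_monic s (fun a => X - C a) (fun a _ => monic_X_sub_C a)
    have := hm.coeff_natDegree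
    rwa [natDegree_multiset_prod_X_sub_C_eq_card] at this
  have hB0 : ((t.map (fun a => X - C a)).prod).coeff 0 ≠ 0 := by
    intro hz
    have hm := (monic_multiset_prod_of_monic t (fun a => X - C a)
      (fun a _ => monic_X_sub_C a)).ne_zero
    apply hm
    ext k
    have := hB k
    rw [hz, norm_zero] at this
    have h1 : ‖((t.map (fun a => X - C a)).prod).coeff k‖ ≤ 0 := by
      by_contra hh
      push Not at hh
      have : 0 < ‖((t.map (fun a => X - C a)).prod).coeff k‖ * r ^ k := by positivity
      linarith
    simpa using h1
  rw [hcard] at hA hc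
  set A := (s.map (fun a => X - C a)).prod
  set B := (t.map (fun a => X - C a)).prod
  have hl : Q.leadingCoeff ≠ 0 := leadingCoeff_ne_zero.2 h0
  have hlp : 0 < ‖Q.leadingCoeff‖ := norm_pos_iff.2 hl
  have hBp : 0 < ‖B.coeff 0‖ := norm_pos_iff.2 hB0
  have e1 : ∀ j, Q.coeff j = Q.leadingCoeff * (A * B).coeff j := by
    intro j
    conv_lhs => rw [e]
    rw [coeff_C_mul]
  have hterm : ∀ i j, i < d → ‖A.coeff i * B.coeff j‖ * r ^ (i + j) < r ^ d * ‖B.coeff 0‖ := by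
    intro i j hi
    rw [norm_mul, pow_add]
    calc _ = (‖A.coeff i‖ * r ^ i) * (‖B.coeff j‖ * r ^ j) := by ring
      _ ≤ (‖A.coeff i‖ * r ^ i) * ‖B.coeff 0‖ := mul_le_mul_of_nonneg_left (hB j) (by positivity)
      _ < _ := mul_lt_mul_of_pos_right (hA i hi) hBp
  -- general bound on partial sums
  have hsum : ∀ (m : ℕ) (S : Finset (ℕ × ℕ)), (∀ x ∈ S, x.1 < d ∧ x.1 + x.2 = m) →
      ‖∑ x ∈ S, A.coeff x.1 * B.coeff x.2‖ * r ^ m < r ^ d * ‖B.coeff 0‖ := by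
    intro m S hS
    rcases S.eq_empty_or_nonempty with hE | hE
    · subst hE; simp; positivity
    · obtain ⟨x, hx, hle⟩ := IsUltrametricDist.exists_norm_finsetSum_le_of_nonempty hE
        (fun x : ℕ × ℕ => A.coeff x.1 * B.coeff x.2)
      have := hterm x.1 x.2 (hS x hx).1
      rw [(hS x hx).2] at this
      exact (mul_le_mul_of_nonneg_right hle (by positivity)).trans_lt this
  have h1 : ‖(A * B).coeff 1‖ * r ^ 1 < r ^ d * ‖B.coeff 0‖ := by
    rw [coeff_mul]
    apply hsum
    intro x hx
    rw [Finset.HasAntidiagonal.mem_antidiagonal] at hx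
    omega
  have h2 : ‖(A * B).coeff d‖ = ‖B.coeff 0‖ := by
    rw [coeff_mul, ← Finset.add_sum_erase _ _
      (show (d, 0) ∈ Finset.HasAntidiagonal.antidiagonal d by simp)]
    have := hsum d ((Finset.HasAntidiagonal.antidiagonal d).erase (d, 0)) (by
      intro x hx
      rw [Finset.mem_erase, Finset.HasAntidiagonal.mem_antidiagonal] at hx
      refine ⟨?_, hx.2⟩
      by_contra hcon
      apply hx.1
      ext <;> simp <;> omega)
    rw [mul_comm] at this
    have := lt_of_mul_lt_mul_left this (by positivity)
    simp only [hc, one_mul]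
    rw [add_comm]
    rw [IsUltrametricDist.norm_add_eq_max_of_norm_ne_norm this.ne, max_eq_right this.le]
  rw [e1, e1, norm_mul, norm_mul, h2, mul_assoc, mul_assoc]
  apply mul_lt_mul_of_pos_left _ hlp
  linarith

lemma aux_prime {K : Type*} [NontriviallyNormedField K] [IsUltrametricDist K]
    (d : ℕ) (hd : 1 ≤ d) (h1 : ‖(d : K)‖ < 1) :
    (resChar K).Prime ∧ ‖((resChar K : ℕ) : K)‖ < 1 ∧
      ∀ m : ℕ, ¬ resChar K ∣ m → ‖(m : K)‖ = 1 := by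
  have hmem : resChar K ∈ {m : ℕ | 2 ≤ m ∧ ‖(m : K)‖ < 1} := by
    apply Nat.sInf_mem
    refine ⟨d, ?_, h1⟩
    by_contra hh
    have : d = 1 := by omega
    subst this
    simp at h1
  have hle : ∀ m : ℕ, ‖(m : K)‖ ≤ 1 := fun m => IsUltrametricDist.norm_natCast_le_one K m
  have hmin : ∀ m : ℕ, 2 ≤ m → m < resChar K → ‖(m : K)‖ = 1 := by
    intro m hm hlt
    refine le_antisymm (hle m) ?_
    by_contra hh
    exact Nat.notMem_of_lt_sInf hlt ⟨hm, not_le.1 hh⟩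
  have hp : (resChar K).Prime := by
    rw [Nat.prime_def]
    refine ⟨hmem.1, fun m hm => ?_⟩
    obtain ⟨c, hc⟩ := hm
    by_contra hcon
    push Not at hcon
    have h2 := hmem.1
    have hm0 : m ≠ 0 := by rintro rfl; simp at hc; omega
    have hc0 : c ≠ 0 := by rintro rfl; simp at hc; omega
    have hc1 : c ≠ 1 := by rintro rfl; simp at hc; omega
    have hm2 : 2 ≤ m := by have := hcon.1; omega
    have hc2 : 2 ≤ c := by omega
    have hml : m < resChar K := by rw [hc]; nlinarith
    have hcl : c < resChar K := by rw [hc]; nlinarith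
    have := hmem.2
    rw [hc, Nat.cast_mul, norm_mul, hmin m hm2 hml, hmin c hc2 hcl] at this
    norm_num at this
  refine ⟨hp, hmem.2, fun m hm => le_antisymm (hle m) ?_⟩
  by_contra hh
  push Not at hh
  have hco : IsCoprime ((resChar K : ℕ) : ℤ) (m : ℤ) :=
    Nat.isCoprime_iff_coprime.2 ((Nat.Prime.coprime_iff_not_dvd hp).2 hm)
  obtain ⟨a, b, hab⟩ := hco
  have hK : (a : K) * ((resChar K : ℕ) : K) + (b : K) * (m : K) = 1 := by
    exact_mod_cast congrArg (Int.cast : ℤ → K) hab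
  have hi : ∀ a : ℤ, ‖(a : K)‖ ≤ 1 := fun a => IsUltrametricDist.norm_intCast_le_one K a
  have hlt : ‖(1 : K)‖ < 1 := by
    rw [← hK]
    refine (IsUltrametricDist.norm_add_le_max _ _).trans_lt (max_lt ?_ ?_)
    · rw [norm_mul]
      exact (mul_le_of_le_one_left (norm_nonneg _) (hi a)).trans_lt hmem.2
    · rw [norm_mul]
      exact (mul_le_of_le_one_left (norm_nonneg _) (hi b)).trans_lt hh
  simp at hlt

lemma aux_ii {K : Type*} [NontriviallyNormedField K] [IsUltrametricDist K] [IsAlgClosed K]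
    (r t : ℝ) (hr : 0 < r) (ht : 0 < t) (Q : K[X]) (hQ0 : Q.coeff 0 = 0)
    (hQ1 : Q.coeff 1 ≠ 0)
    (h : ∀ k : ℕ, ‖((k+1 : ℕ) : K)‖ * ‖Q.coeff (k+1)‖ * r ^ k ≤ ‖Q.coeff 1‖)
    (hk : ∀ k : ℕ, t ^ k ≤ ‖((k+1 : ℕ) : K)‖)
    (w : K) (hw : ‖w‖ < t * r) (hQw : Q.eval w = 0) : w = 0 := by
  by_contra hw0
  have hwp : 0 < ‖w‖ := norm_pos_iff.2 hw0
  have h1p : 0 < ‖Q.coeff 1‖ := norm_pos_iff.2 hQ1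
  rw [eval_eq_sum_range' (show Q.natDegree < Q.natDegree + 2 by omega),
    ← Finset.add_sum_erase _ _ (show 1 ∈ Finset.range (Q.natDegree + 2) by simp)] at hQw
  have hS : ‖∑ x ∈ (Finset.range (Q.natDegree + 2)).erase 1, Q.coeff x * w ^ x‖
      = ‖Q.coeff 1‖ * ‖w‖ := by
    rw [← norm_mul, ← norm_neg (Q.coeff 1 * w)]
    congr 1
    linear_combination hQw
  obtain ⟨k, hkm, hle⟩ := IsUltrametricDist.exists_norm_finsetSum_le_of_nonempty
    (show ((Finset.range (Q.natDegree + 2)).erase 1).Nonempty from ⟨0, by simp⟩)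
    (fun x => Q.coeff x * w ^ x)
  rw [hS] at hle
  have hk0 : k ≠ 0 := by
    rintro rfl
    simp only [hQ0, zero_mul, norm_zero] at hle
    have : 0 < ‖Q.coeff 1‖ * ‖w‖ := by positivity
    linarith
  have hk1 : k ≠ 1 := (Finset.mem_erase.1 hkm).1
  obtain ⟨j, rfl⟩ : ∃ j, k = j + 1 := ⟨k - 1, by omega⟩
  have hj : j ≠ 0 := by omega
  rw [norm_mul, norm_pow, pow_succ, ← mul_assoc] at hle
  have hle := le_of_mul_le_mul_right hle hwp
  have hap : 0 < ‖Q.coeff (j+1)‖ := by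
    by_contra hh
    have : ‖Q.coeff (j+1)‖ = 0 := le_antisymm (not_lt.1 hh) (norm_nonneg _)
    rw [this] at hle
    linarith
  have h2 : t ^ j * ‖Q.coeff (j+1)‖ * r ^ j ≤ ‖Q.coeff (j+1)‖ * ‖w‖ ^ j := by
    refine le_trans ?_ ((h j).trans hle)
    gcongr
    exact hk j
  have h3 : ‖w‖ ^ j < (t * r) ^ j := pow_lt_pow_left₀ hw (norm_nonneg _) hj
  rw [mul_pow] at h3
  have := mul_lt_mul_of_pos_left h3 hap
  linarith

theorem injectivity_radius
    {K : Type*} [NontriviallyNormedField K] [IsAlgClosed K]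
    [CompleteSpace K] [IsUltrametricDist K]
    (P : Polynomial K) (hP : 0 < P.natDegree)
    (r : ℝ) (hr : 0 < r)
    (hcrit : ∀ c : K, P.derivative.eval c = 0 → r ≤ ‖c‖)
    (d : ℕ) (hd : 1 ≤ d)
    (hfiber : ∀ u : K, ‖u‖ < r → {z : K | ‖z‖ < r ∧ P.eval z = P.eval u}.ncard = d) :
    (‖(d : K)‖ = 1 → Set.InjOn (fun z => P.eval z) {z : K | ‖z‖ < r}) ∧
    (0 < ‖(d : K)‖ → ‖(d : K)‖ < 1 →
      Set.InjOn (fun z => P.eval z)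
        {z : K | ‖z‖ <
          ‖((resChar K : ℕ) : K)‖ ^ ((1 : ℝ) / ((resChar K : ℝ) - 1)) * r}) := by
  have hlt_add : ∀ (s : ℝ) (x y : K), ‖x‖ < s → ‖y‖ < s → ‖x + y‖ < s := fun s x y hx hy =>
    (IsUltrametricDist.norm_add_le_max x y).trans_lt (max_lt hx hy)
  have hlt_sub : ∀ (s : ℝ) (x y : K), ‖x‖ < s → ‖y‖ < s → ‖x - y‖ < s := fun s x y hx hy => by
    rw [sub_eq_add_neg]; exact hlt_add s x (-y) hx (by rwa [norm_neg])
  -- translated polynomial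
  have main : ∀ u : K, ‖u‖ < r → ∃ Q : K[X], Q.coeff 0 = 0 ∧ Q.coeff 1 ≠ 0 ∧
      (∀ z, Q.eval z = P.eval (z + u) - P.eval u) ∧
      (∀ c : K, Q.derivative.eval c = 0 → r ≤ ‖c‖) ∧
      (∀ k : ℕ, ‖((k+1 : ℕ) : K)‖ * ‖Q.coeff (k+1)‖ * r ^ k ≤ ‖Q.coeff 1‖) := by
    intro u hu
    set Q : K[X] := P.comp (X + C u) - C (P.eval u) with hQ
    have hev : ∀ z, Q.eval z = P.eval (z + u) - P.eval u := by
      intro z; simp [hQ]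
    have hde : ∀ z, Q.derivative.eval z = P.derivative.eval (z + u) := by
      intro z; simp [hQ, derivative_comp]
    have hc : ∀ c : K, Q.derivative.eval c = 0 → r ≤ ‖c‖ := by
      intro c h
      rw [hde] at h
      have := hcrit _ h
      by_contra hh
      exact absurd (hlt_add r c u (not_le.1 hh) hu) (not_lt.2 this)
    have hc0 : Q.derivative.eval 0 ≠ 0 := by
      intro h
      have := hc 0 h
      rw [norm_zero] at this
      linarith
    refine ⟨Q, ?_, ?_, hev, hc, ?_⟩
    · rw [coeff_zero_eq_eval_zero, hev]; simp
    · rw [← coeff_zero_eq_eval_zero, coeff_derivative] at hc0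
      simpa using hc0
    · apply aux_der r hr Q _ hc
      intro h
      rw [h] at hc0
      simp at hc0
  constructor
  · intro hd1
    have hd1' : d = 1 := by
      by_contra hne
      obtain ⟨Q, q0, q1, hev, hc, hk⟩ := main 0 (by simpa using hr)
      have hf := hfiber 0 (by simpa using hr)
      have hQne : Q ≠ 0 := by rintro rfl; simp at q1
      have h1 := aux_d r hr Q hQne q0 hc d (by omega) (by
        rw [← hf]
        congr 1
        ext z
        simp [hev, sub_eq_zero])
      obtain ⟨j, rfl⟩ : ∃ j, d = j + 1 := ⟨d - 1, by omega⟩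
      have h2 := hk j
      rw [hd1, one_mul] at h2
      have h3 := mul_le_mul_of_nonneg_right h2 hr.le
      rw [pow_succ] at h1
      linarith
    subst hd1'
    intro x hx y hy hxy
    obtain ⟨a, ha⟩ := Set.ncard_eq_one.1 (hfiber y hy)
    have hxa : x ∈ ({a} : Set K) := by rw [← ha]; exact ⟨hx, hxy⟩
    have hya : y ∈ ({a} : Set K) := by rw [← ha]; exact ⟨hy, rfl⟩
    rw [Set.mem_singleton_iff] at hxa hya
    rw [hxa, hya]
  · intro hd0 hd1
    obtain ⟨hp, hp1, hpn⟩ := aux_prime d hd hd1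
    set p := resChar K
    have hpd : p ∣ d := by
      by_contra hh
      have := hpn d hh
      linarith
    have hp0 : 0 < ‖(p : K)‖ := by
      rw [norm_pos_iff]
      intro h
      obtain ⟨c, hc⟩ := hpd
      rw [hc, Nat.cast_mul, h, zero_mul, norm_zero] at hd0
      exact lt_irrefl _ hd0
    set t : ℝ := ‖(p : K)‖ ^ ((1 : ℝ) / ((p : ℝ) - 1)) with htdef
    have ht0 : 0 < t := Real.rpow_pos_of_pos hp0 _
    have hp2 : (2 : ℝ) ≤ p := by exact_mod_cast hp.two_le
    have ht1 : t ≤ 1 := Real.rpow_le_one hp0.le hp1.le (by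
      apply div_nonneg zero_le_one; linarith)
    have htp : t ^ (p - 1) = ‖(p : K)‖ := by
      rw [htdef, ← Real.rpow_natCast, ← Real.rpow_mul hp0.le, Nat.cast_sub hp.one_le,
        Nat.cast_one, one_div, inv_mul_cancel₀ (by linarith), Real.rpow_one]
    have hkk : ∀ k : ℕ, t ^ k ≤ ‖((k+1 : ℕ) : K)‖ := by
      intro k
      obtain ⟨v, m, hm, hkm⟩ := Nat.exists_eq_pow_mul_and_not_dvd (Nat.succ_ne_zero k) p hp.ne_one
      rw [Nat.succ_eq_add_one] at hkm
      rw [hkm, Nat.cast_mul, norm_mul, hpn m hm, mul_one, Nat.cast_pow, norm_pow, ← htp, ← pow_mul]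
      apply pow_le_pow_of_le_one ht0.le ht1
      have hm1 : 1 ≤ m := Nat.one_le_iff_ne_zero.2 (by rintro rfl; simp at hm)
      have hb : ∀ v : ℕ, (p - 1) * v + 1 ≤ p ^ v := by
        intro v
        induction v with
        | zero => simp
        | succ v ih =>
          obtain ⟨q, hq⟩ : ∃ q, p = q + 1 := ⟨p - 1, by have := hp.one_le; omega⟩
          rw [hq, Nat.add_sub_cancel] at ih ⊢
          rw [pow_succ]
          nlinarith [Nat.zero_le (q * (q * v))]
      have h2 : p ^ v ≤ p ^ v * m := Nat.le_mul_of_pos_right _ hm1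
      have := hb v
      omega
    intro x hx y hy hxy
    simp only [Set.mem_ofPred_eq] at hx hy hxy
    have htr : t * r ≤ r := mul_le_of_le_one_left hr.le ht1
    obtain ⟨Q, q0, q1, hev, hc, hk⟩ := main y (hy.trans_le htr)
    have := aux_ii r t hr ht0 Q q0 q1 hk hkk (x - y) (hlt_sub _ x y hx hy) (by
      rw [hev, sub_add_cancel, hxy, sub_self])
    exact sub_eq_zero.1 this
end

section
/- (Sharpness of Corollary 1.5: the example Q_1 = X − X^d) Let d ≥ 2 be an integer such that |m| = 1 for every integer m with 1 ≤ m ≤ d−1, and |d| > 0 (so λ(d) = |d|). Let Q_1 := X − X^d. Then: (a) every root z ≠ 0 of Q_1 satisfies |z| = 1 (so the shortest distance from 0 to a root of Q_1 distinct from 0 is 1, and |Q_1'(0)| = 1); and (b) every c ∈ K with Q_1'(c) = 0 satisfies d·c^{d−1} = 1 in K, |c| = |d|^{−1/(d−1)}, and |Q_1(c)| = |d|^{−d/(d−1)}. In particular every critical value v = Q_1(c) satisfies |v − Q_1(0)| = |d|^{−d/(d−1)} = γ(d)·λ(d)^{−1}·|Q_1'(0)|·1, so equality holds in the bound of Corollary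 1.5 at z0 = 0. -/
/-!
STATEMENT 11 (Sharpness of Corollary 1.5, example `Q₁ = X − X^d`): Let `d ≥ 2` with
`‖m‖ = 1` for `1 ≤ m ≤ d−1` and `‖d‖ > 0` (so `lam K d = ‖d‖`).  Then (a) every nonzero
root `z` of `Q₁` has `‖z‖ = 1`; and (b) every critical point `c` of `Q₁` satisfies
`d·c^(d−1) = 1`, `‖c‖ = ‖d‖^(−1/(d−1))` and `‖Q₁(c)‖ = ‖d‖^(−d/(d−1))`.
-/

open Polynomial

theorem sharpness_Q1
    {K : Type*} [NontriviallyNormedField K] [IsAlgClosed K]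
    [CompleteSpace K] [IsUltrametricDist K]
    (d : ℕ) (hd : 2 ≤ d)
    (h1 : ∀ m : ℕ, 1 ≤ m → m ≤ d - 1 → ‖(m : K)‖ = 1)
    (hdpos : 0 < ‖(d : K)‖) :
    (∀ z : K, z ≠ 0 → (Polynomial.X - Polynomial.X ^ d : Polynomial K).eval z = 0 →
      ‖z‖ = 1) ∧
    (∀ c : K, (Polynomial.X - Polynomial.X ^ d : Polynomial K).derivative.eval c = 0 →
      (d : K) * c ^ (d - 1) = 1 ∧
      ‖c‖ = ‖(d : K)‖ ^ (-(1 : ℝ) / ((d : ℝ) - 1)) ∧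
      ‖(Polynomial.X - Polynomial.X ^ d : Polynomial K).eval c‖ =
        ‖(d : K)‖ ^ (-(d : ℝ) / ((d : ℝ) - 1))) := by
  obtain ⟨n, rfl⟩ : ∃ n, d = n + 1 := ⟨d - 1, by omega⟩
  have hn : n ≠ 0 := by omega
  have hnR : (n : ℝ) ≠ 0 := by exact_mod_cast hn
  have hn1 : ‖(n : K)‖ = 1 := h1 n (by omega) (by omega)
  refine ⟨?_, ?_⟩
  · intro z hz h
    simp only [eval_sub, eval_X, eval_pow] at h
    have h2 : z * (1 - z ^ n) = 0 := by rw [← h]; ring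
    have h3 : z ^ n = 1 := by
      rcases mul_eq_zero.mp h2 with h3 | h3
      · exact absurd h3 hz
      · exact (sub_eq_zero.mp h3).symm
    have h4 : ‖z‖ ^ n = 1 := by rw [← norm_pow, h3, norm_one]
    exact (pow_eq_one_iff_of_nonneg (norm_nonneg z) hn).mp h4
  · intro c h
    have hc : ((n + 1 : ℕ) : K) * c ^ n = 1 := by
      simp [derivative_X_pow] at h
      push_cast
      exact (sub_eq_zero.mp h).symm
    have hcn : ‖((n + 1 : ℕ) : K)‖ * ‖c‖ ^ n = 1 := by
      rw [← norm_pow, ← norm_mul, hc, norm_one]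
    have hexp : ((n + 1 : ℕ) : ℝ) - 1 = n := by push_cast; ring
    have hnc : ‖c‖ = ‖((n + 1 : ℕ) : K)‖ ^ (-(1 : ℝ) / (((n + 1 : ℕ) : ℝ) - 1)) := by
      have h5 : ‖((n + 1 : ℕ) : K)‖ = (‖c‖ ^ n)⁻¹ := eq_inv_of_mul_eq_one_left hcn
      have h6 : 0 ≤ ‖c‖ := norm_nonneg c
      rw [hexp, h5, neg_div, Real.rpow_neg (by positivity), Real.inv_rpow (by positivity),
        inv_inv, one_div, Real.pow_rpow_inv_natCast h6 hn]
    refine ⟨hc, hnc, ?_⟩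
    have h7 : ((n + 1 : ℕ) : K) * (c - c ^ (n + 1)) = c * n := by
      have : ((n + 1 : ℕ) : K) * (c - c ^ (n + 1))
          = ((n + 1 : ℕ) : K) * c - c * (((n + 1 : ℕ) : K) * c ^ n) := by ring
      rw [this, hc]; push_cast; ring
    have h8 : ‖((n + 1 : ℕ) : K)‖ * ‖c - c ^ (n + 1)‖ = ‖c‖ := by
      rw [← norm_mul, h7, norm_mul, hn1, mul_one]
    simp only [eval_sub, eval_X, eval_pow]
    have h9 : -((n + 1 : ℕ) : ℝ) / (((n + 1 : ℕ) : ℝ) - 1)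
        = -(1 : ℝ) / (((n + 1 : ℕ) : ℝ) - 1) - 1 := by
      rw [hexp]; push_cast; field_simp; ring
    rw [h9, Real.rpow_sub_one hdpos.ne', ← hnc, eq_div_iff hdpos.ne', mul_comm]
    exact h8
end

section
/- (Sharpness of Theorem C: the example Q_0) Let d ≥ 2 be an integer with λ(d) > 0, let q be an integer with 1 ≤ q ≤ d−1 and |q| = λ(d), and let ε ∈ K with 0 < |ε|·|d| < |q|. Define the rational map Q_0 := f/g with f := (1 + ε − εX)^d and g := X^q (these polynomials are coprime). Then: (a) Q_0(1) = 1 and Q_0'(1) = −(q + εd), so |Q_0'(1)| = |q| = λ(d); (b) 0 is the only pole of Q_0, so the shortest distance from 1 to a pole of Q_0 is r = 1; (c) 0 is a finite critical value of Q_0 (the image of the critical point 1 + ε^{−1}); and (d) every finite critical value v of Q_0 satisfies |v − 1| ≥ 1 = λ(d)^{−1}·|Q_0'(1)|·r. Hence equality holds in the bound of Theorem C at z0 = 1. -/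
/-!
STATEMENT 12 (Sharpness of Theorem C, example `Q₀ = (1 + ε − εX)^d / X^q`): Let `d ≥ 2`
with `lam K d > 0`, let `1 ≤ q ≤ d − 1` with `‖q‖ = lam K d`, and let `ε ∈ K` with
`0 < ‖ε‖·‖d‖ < ‖q‖`.  With `f = (1 + ε − εX)^d` and `g = X^q` (coprime): (a)
`Q₀(1) = 1`, `Q₀'(1) = −(q + εd)`, of norm `lam K d`; (b) `0` is the only pole of `Q₀`;
(c) `0` is a finite critical value of `Q₀`, image of the critical point `1 + ε⁻¹`; and
(d) every finite critical value `v` of `Q₀` satisfies `‖v − 1‖ ≥ 1`.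
-/

open Polynomial

/-- The numerator `f = (1 + ε − εX)^d` of the example `Q₀`. -/
noncomputable def f12 {K : Type*} [Field K] (d : ℕ) (ε : K) : Polynomial K :=
  (Polynomial.C (1 + ε) - Polynomial.C ε * Polynomial.X) ^ d

/-- The denominator `g = X^q` of the example `Q₀`. -/
noncomputable def g12 (K : Type*) [Field K] (q : ℕ) : Polynomial K :=
  Polynomial.X ^ q

/-- The numerator `f'g − fg'` of the derivative of `Q₀`. -/
noncomputable def num12 {K : Type*} [Field K] (d q : ℕ) (ε : K) : Polynomial K :=
  (f12 d ε).derivative * g12 K q - f12 d ε * (g12 K q).derivative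

theorem lam_le_aux (K : Type*) [NormedField K] (d m : ℕ) (h1 : 1 ≤ m) (h2 : m ≤ d) :
    lam K d ≤ ‖(m : K)‖ := by
  have hb : BddBelow (Set.range fun m : Finset.Icc 1 d => ‖((m : ℕ) : K)‖) :=
    ⟨0, by rintro _ ⟨x, rfl⟩; exact norm_nonneg _⟩
  exact ciInf_le hb ⟨m, Finset.mem_Icc.2 ⟨h1, h2⟩⟩

theorem num_eval_aux {K : Type*} [Field K] (d q : ℕ) (ε c : K) :
    (num12 d q ε).eval c = -(ε * d * (1 + ε - ε * c) ^ (d - 1) * c ^ q)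
      - (1 + ε - ε * c) ^ d * (q * c ^ (q - 1)) := by
  simp only [num12, f12, g12, derivative_pow, derivative_sub, derivative_mul, derivative_C,
    derivative_X, eval_sub, eval_mul, eval_pow, eval_add, eval_C, eval_X, eval_zero, eval_one]
  ring

theorem norm_sub_one_aux {K : Type*} [NormedField K] [IsUltrametricDist K] (v : K)
    (hv : ‖v‖ < 1) : 1 ≤ ‖v - 1‖ := by
  by_contra! h
  have h1 : ‖v - (v - 1)‖ ≤ max ‖v‖ ‖v - 1‖ := by
    rw [sub_eq_add_neg, ← norm_neg (v - 1)]
    exact IsUltrametricDist.norm_add_le_max _ _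
  rw [sub_sub_cancel, norm_one] at h1
  exact absurd h1 (not_le.2 (max_lt hv h))

theorem sharpness_Q0
    {K : Type*} [NontriviallyNormedField K] [IsAlgClosed K]
    [CompleteSpace K] [IsUltrametricDist K]
    (d q : ℕ) (hd : 2 ≤ d) (hlam : 0 < lam K d)
    (hq1 : 1 ≤ q) (hq2 : q ≤ d - 1) (hqlam : ‖(q : K)‖ = lam K d)
    (ε : K) (hε : ε ≠ 0) (hεd : ‖ε‖ * ‖(d : K)‖ < ‖(q : K)‖) :
    IsCoprime (f12 d ε) (g12 K q) ∧
    -- (a)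
    (f12 d ε).eval 1 / (g12 K q).eval 1 = 1 ∧
    (num12 d q ε).eval 1 / ((g12 K q).eval 1) ^ 2 = -((q : K) + ε * d) ∧
    ‖(num12 d q ε).eval 1 / ((g12 K q).eval 1) ^ 2‖ = lam K d ∧
    -- (b)
    (∀ π : K, (g12 K q).eval π = 0 → π = 0) ∧
    -- (c)
    ((g12 K q).eval (1 + ε⁻¹) ≠ 0 ∧ (num12 d q ε).eval (1 + ε⁻¹) = 0 ∧
      (f12 d ε).eval (1 + ε⁻¹) / (g12 K q).eval (1 + ε⁻¹) = 0) ∧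
    -- (d)
    (∀ c : K, (g12 K q).eval c ≠ 0 → (num12 d q ε).eval c = 0 →
      1 ≤ ‖(f12 d ε).eval c / (g12 K q).eval c - 1‖) := by
  have hlq := lam_le_aux K d
  have hdq : ‖(q : K)‖ ≤ ‖(d : K)‖ := hqlam ▸ hlq d (by omega) le_rfl
  have hq0 : 0 < ‖(q : K)‖ := hqlam ▸ hlam
  have hd0 : 0 < ‖(d : K)‖ := hq0.trans_le hdq
  have hqK : (q : K) ≠ 0 := norm_pos_iff.1 hq0
  have hdqs : ‖(q : K)‖ ≤ ‖(d : K) - q‖ := by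
    rw [hqlam, ← Nat.cast_sub (by omega)]
    exact hlq _ (by omega) (by omega)
  have hs0 : 0 < ‖(d : K) - q‖ := hq0.trans_le hdqs
  have hds : ‖(d : K) - q‖ ≤ ‖(d : K)‖ :=
    sub_eq_add_neg (d : K) q ▸ (IsUltrametricDist.norm_add_le_max _ _).trans
      (max_le le_rfl ((norm_neg _).trans_le hdq))
  have hsd : ‖(d : K)‖ ≤ ‖(d : K) - q‖ := by
    have h := IsUltrametricDist.norm_add_le_max ((d : K) - q) q
    rw [sub_add_cancel] at h
    exact h.trans (max_le le_rfl hdqs)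
  have hε1 : ‖ε‖ < 1 := by
    by_contra! h
    nlinarith
  have h1ε : ‖1 + ε‖ = 1 := by
    rw [IsUltrametricDist.norm_add_eq_max_of_norm_ne_norm (by rw [norm_one]; exact hε1.ne'),
      norm_one, max_eq_left hε1.le]
  have h1ε0 : 1 + ε ≠ 0 := by
    rw [← norm_pos_iff, h1ε]; exact one_pos
  have hf : ∀ c, (f12 d ε).eval c = (1 + ε - ε * c) ^ d := by intro c; simp [f12]
  have hg : ∀ c, (g12 K q).eval c = c ^ q := by intro c; simp [g12]
  have hnum1 : (num12 d q ε).eval 1 / ((g12 K q).eval 1) ^ 2 = -((q : K) + ε * d) := by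
    rw [num_eval_aux, hg]; simp; ring
  have hcz : 1 + ε - ε * (1 + ε⁻¹) = 0 := by field_simp; ring
  have hc0 : 1 + ε⁻¹ ≠ 0 := by
    intro h
    rw [h] at hcz
    exact h1ε0 (by simpa using hcz)
  refine ⟨?_, ?_, hnum1, ?_, ?_, ⟨?_, ?_, ?_⟩, ?_⟩
  · unfold f12 g12
    apply IsCoprime.pow
    refine ⟨C (1 + ε)⁻¹, C ((1 + ε)⁻¹ * ε), ?_⟩
    rw [mul_sub, ← C_mul, inv_mul_cancel₀ h1ε0, C_mul, C_1]
    ring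
  · rw [hf, hg]; simp
  · rw [hnum1, norm_neg, ← hqlam]
    have h : ‖ε * (d : K)‖ < ‖(q : K)‖ := by rwa [norm_mul]
    rw [IsUltrametricDist.norm_add_eq_max_of_norm_ne_norm h.ne', max_eq_left h.le]
  · intro π h
    rw [hg] at h
    exact pow_eq_zero_iff (by omega) |>.1 h
  · rw [hg]; exact pow_ne_zero _ hc0
  · rw [num_eval_aux, hcz, zero_pow (by omega), zero_pow (by omega)]; simp
  · rw [hf, hcz, zero_pow (by omega), zero_div]
  · intro c hgc hnc
    rw [hg] at hgc
    have hcne : c ≠ 0 := by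
      rintro rfl
      exact hgc (zero_pow (by omega))
    rw [hf, hg]
    apply norm_sub_one_aux
    rw [num_eval_aux] at hnc
    by_cases hu : 1 + ε - ε * c = 0
    · rw [hu, zero_pow (by omega)]; simp
    have e1 : (1 + ε - ε * c) ^ d = (1 + ε - ε * c) ^ (d - 1) * (1 + ε - ε * c) := by
      rw [← pow_succ]; congr 1; omega
    have e2 : c ^ q = c ^ (q - 1) * c := by
      rw [← pow_succ]; congr 1; omega
    rw [e1, e2] at hnc
    have h0 : ε * d * c + q * (1 + ε - ε * c) = 0 := by
      have hp : (1 + ε - ε * c) ^ (d - 1) * c ^ (q - 1) ≠ 0 :=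
        mul_ne_zero (pow_ne_zero _ hu) (pow_ne_zero _ hcne)
      apply (mul_eq_zero.1 _).resolve_left hp
      linear_combination -hnc
    have hc1 : ‖ε‖ * ‖(d : K) - q‖ * ‖c‖ = ‖(q : K)‖ := by
      have : ε * ((d : K) - q) * c = -(q * (1 + ε)) := by linear_combination h0
      have := congrArg norm this
      rwa [norm_mul, norm_mul, norm_neg, norm_mul, h1ε, mul_one] at this
    have hu1 : ‖1 + ε - ε * c‖ ≤ 1 := by
      have : ((d : K) - q) * (1 + ε - ε * c) = d * (1 + ε) := by linear_combination -h0
      have := congrArg norm this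
      rw [norm_mul, norm_mul, h1ε, mul_one] at this
      by_contra! h
      nlinarith
    have hcgt : 1 < ‖c‖ := by
      by_contra! h
      have : ‖ε‖ * ‖(d : K) - q‖ * ‖c‖ ≤ ‖ε‖ * ‖(d : K)‖ * 1 := by gcongr
      linarith
    rw [norm_div, norm_pow, norm_pow]
    have hcq : 1 < ‖c‖ ^ q := one_lt_pow₀ hcgt (by omega)
    rw [div_lt_one (by linarith)]
    exact (pow_le_one₀ (norm_nonneg _) hu1).trans_lt hcq
end

section
/- (Attracting cycles of every period with multiplier norm λ(d)^{#O}: the example P_0) Suppose K has characteristic 0 and there is an integer m ≥ 2 with |m| < 1; let p be the smallest such m (the residue characteristic of K, a prime) and suppose |p| < 1. Let d ≥ 2 be an integer with p ≤ d such that p does not divide d or p² divides d, and put P_0 := X^p − p^d·X^d. Then: (a) for every z ∈ K with |z| = 1 one has |P_0'(z)| = |p|; and (b) for every integer n ≥ 1 there exists z ∈ K with |z| = 1 such that P_0^n(z) = z and P_0^m(z) ≠ z for every 1 ≤ m < n. Consequently, for each n ≥ 1 the polynomial P_0 has a cycle of period exactly n contained in {z : |z| = 1}, whose multiplier has absolute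 value |p|^n < 1 (so the cycle is attracting). -/
/-!
STATEMENT 13 (Attracting cycles of every period with multiplier norm `|p|^n`, example
`P₀ = X^p − p^d·X^d`): Suppose `K` has characteristic `0` and residue characteristic
`p` (the smallest integer `m ≥ 2` with `‖m‖ < 1`) with `‖p‖ < 1`.  Let `d ≥ 2` with
`p ≤ d` and (`p ∤ d` or `p² ∣ d`).  Then: (a) `‖P₀'(z)‖ = ‖p‖` for every `‖z‖ = 1`;
and (b) for every `n ≥ 1` there is a periodic point `z` of `P₀` of exact period `n` on
the unit sphere, whose multiplier has norm `‖p‖^n`.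
-/

open Polynomial Filter

/-- The polynomial `P₀ = X^p − p^d·X^d`. -/
noncomputable def P0 {K : Type*} [Field K] (p d : ℕ) : Polynomial K :=
  Polynomial.X ^ p - Polynomial.C ((p : K) ^ d) * Polynomial.X ^ d

section Helpers

variable {K : Type*} [NontriviallyNormedField K] [IsUltrametricDist K]

theorem aux_sub_le {a b : K} {r : ℝ} (ha : ‖a‖ ≤ r) (hb : ‖b‖ ≤ r) : ‖a - b‖ ≤ r := by
  rw [sub_eq_add_neg]
  exact (IsUltrametricDist.norm_add_le_max a (-b)).trans (max_le ha (by rwa [norm_neg]))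

theorem aux_add_le {a b : K} {r : ℝ} (ha : ‖a‖ ≤ r) (hb : ‖b‖ ≤ r) : ‖a + b‖ ≤ r :=
  (IsUltrametricDist.norm_add_le_max a b).trans (max_le ha hb)

theorem aux_sum_le {s : Finset ℕ} {f : ℕ → K} {r : ℝ} (hr : 0 ≤ r)
    (h : ∀ i ∈ s, ‖f i‖ ≤ r) : ‖∑ i ∈ s, f i‖ ≤ r := by
  classical
  induction s using Finset.induction_on with
  | empty => simpa using hr
  | insert a s ha ih =>
    rw [Finset.sum_insert ha]
    exact aux_add_le (h a (Finset.mem_insert_self _ _))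
      (ih fun i hi => h i (Finset.mem_insert_of_mem hi))

theorem aux_sum_pow {x y : K} (hx : ‖x‖ ≤ 1) (hy : ‖y‖ ≤ 1) (k : ℕ) :
    ‖∑ i ∈ Finset.range k, x ^ i * y ^ (k - 1 - i)‖ ≤ 1 := by
  refine aux_sum_le zero_le_one fun i _ => ?_
  rw [norm_mul, norm_pow, norm_pow]
  exact mul_le_one₀ (pow_le_one₀ (norm_nonneg _) hx) (by positivity)
    (pow_le_one₀ (norm_nonneg _) hy)

theorem aux_pow_sub {x y : K} (hx : ‖x‖ ≤ 1) (hy : ‖y‖ ≤ 1) (k : ℕ) :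
    ‖x ^ k - y ^ k‖ ≤ ‖x - y‖ := by
  rw [← (Commute.all x y).geom_sum₂_mul, norm_mul]
  exact mul_le_of_le_one_left (norm_nonneg _) (aux_sum_pow hx hy k)

theorem aux_norm_one {x w : K} (hw : ‖w‖ = 1) (h : ‖x - w‖ < 1) : ‖x‖ = 1 := by
  have : x = (x - w) + w := by ring
  rw [this, IsUltrametricDist.norm_add_eq_max_of_norm_ne_norm (by rw [hw]; exact h.ne), hw]
  exact max_eq_right h.le

theorem aux_pow_p_sub {p : ℕ} {x y : K} (hx : ‖x‖ ≤ 1) (hy : ‖y‖ ≤ 1)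
    (hp : ‖(p : K)‖ ≤ 1) (hxy : ‖x - y‖ ≤ ‖(p : K)‖) :
    ‖x ^ p - y ^ p‖ ≤ ‖(p : K)‖ * ‖x - y‖ := by
  rw [← (Commute.all x y).geom_sum₂_mul, norm_mul]
  refine mul_le_mul_of_nonneg_right ?_ (norm_nonneg _)
  have h1 : ∑ i ∈ Finset.range p, x ^ i * y ^ (p - 1 - i) =
      ∑ i ∈ Finset.range p, (x ^ i - y ^ i) * y ^ (p - 1 - i) + p * y ^ (p - 1) := by
    have : (p : K) * y ^ (p - 1) = ∑ i ∈ Finset.range p, y ^ i * y ^ (p - 1 - i) := by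
      rw [Finset.sum_congr rfl (g := fun _ => y ^ (p - 1))]
      · simp
      · intro i hi
        rw [Finset.mem_range] at hi
        rw [← pow_add]
        congr 1
        omega
    rw [this, ← Finset.sum_add_distrib]
    refine Finset.sum_congr rfl fun i _ => by ring
  rw [h1]
  refine aux_add_le (aux_sum_le (norm_nonneg _) fun i _ => ?_) ?_
  · rw [norm_mul, norm_pow]
    exact (mul_le_of_le_one_right (norm_nonneg _) (pow_le_one₀ (norm_nonneg _) hy)).trans
      ((aux_pow_sub hx hy i).trans hxy)
  · rw [norm_mul, norm_pow]
    exact mul_le_of_le_one_right (norm_nonneg _) (pow_le_one₀ (norm_nonneg _) hy)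

theorem aux_eval (p d : ℕ) (z : K) :
    (P0 p d (K := K)).eval z = z ^ p - (p : K) ^ d * z ^ d := by
  simp [P0]

theorem aux_P_sub {p d : ℕ} (hd : 1 ≤ d) {x y : K} (hx : ‖x‖ ≤ 1) (hy : ‖y‖ ≤ 1)
    (hp : ‖(p : K)‖ ≤ 1) (hxy : ‖x - y‖ ≤ ‖(p : K)‖) :
    ‖(P0 p d (K := K)).eval x - (P0 p d (K := K)).eval y‖ ≤ ‖(p : K)‖ * ‖x - y‖ := by
  rw [aux_eval, aux_eval]
  have : x ^ p - (p : K) ^ d * x ^ d - (y ^ p - (p : K) ^ d * y ^ d) =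
    (x ^ p - y ^ p) - (p : K) ^ d * (x ^ d - y ^ d) := by ring
  rw [this]
  refine aux_sub_le (aux_pow_p_sub hx hy hp hxy) ?_
  rw [norm_mul, norm_pow]
  exact mul_le_mul (pow_le_of_le_one (norm_nonneg _) hp (by omega)) (aux_pow_sub hx hy d)
    (norm_nonneg _) (norm_nonneg _)

theorem aux_iter_mem {p d : ℕ} (hd : 1 ≤ d) {w x : K} (hw : ‖w‖ = 1)
    (hp : ‖(p : K)‖ < 1) (hxw : ‖x - w‖ ≤ ‖(p : K)‖) (k : ℕ) :
    ‖(fun w => (P0 p d (K := K)).eval w)^[k] x - w ^ (p ^ k)‖ ≤ ‖(p : K)‖ := by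
  induction k with
  | zero => simpa using hxw
  | succ k ih =>
    rw [Function.iterate_succ_apply']
    set u := (fun w => (P0 p d (K := K)).eval w)^[k] x
    have hv : ‖w ^ (p ^ k)‖ = 1 := by rw [norm_pow, hw, one_pow]
    have hu : ‖u‖ = 1 := aux_norm_one hv (ih.trans_lt hp)
    rw [pow_succ, pow_mul]
    simp only [aux_eval]
    rw [sub_right_comm]
    refine aux_sub_le ((aux_pow_sub hu.le hv.le p).trans ih) ?_
    rw [norm_mul, norm_pow, norm_pow, hu, one_pow, mul_one]
    exact pow_le_of_le_one (norm_nonneg _) hp.le (by omega)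

theorem aux_iter_sub {p d : ℕ} (hd : 1 ≤ d) {w x y : K} (hw : ‖w‖ = 1)
    (hp : ‖(p : K)‖ < 1) (hxw : ‖x - w‖ ≤ ‖(p : K)‖) (hyw : ‖y - w‖ ≤ ‖(p : K)‖) (k : ℕ) :
    ‖(fun w => (P0 p d (K := K)).eval w)^[k] x - (fun w => (P0 p d (K := K)).eval w)^[k] y‖
      ≤ ‖(p : K)‖ ^ k * ‖x - y‖ := by
  induction k with
  | zero => simp
  | succ k ih =>
    rw [Function.iterate_succ_apply', Function.iterate_succ_apply']
    have hx := aux_iter_mem hd hw hp hxw k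
    have hy := aux_iter_mem hd hw hp hyw k
    set u := (fun w => (P0 p d (K := K)).eval w)^[k] x
    set v := (fun w => (P0 p d (K := K)).eval w)^[k] y
    have hwk : ‖w ^ (p ^ k)‖ = 1 := by rw [norm_pow, hw, one_pow]
    have hu : ‖u‖ = 1 := aux_norm_one hwk (hx.trans_lt hp)
    have hv : ‖v‖ = 1 := aux_norm_one hwk (hy.trans_lt hp)
    have huv : ‖u - v‖ ≤ ‖(p : K)‖ := by
      have : u - v = (u - w ^ (p ^ k)) - (v - w ^ (p ^ k)) := by ring
      rw [this]
      exact aux_sub_le hx hy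
    refine (aux_P_sub hd hu.le hv.le hp.le huv).trans ?_
    rw [pow_succ', mul_assoc]
    exact mul_le_mul_of_nonneg_left ih (norm_nonneg _)

theorem aux_root {N : ℕ} (hN : ‖(N : K)‖ = 1) {u : K} (hu1 : ‖u‖ ≤ 1) (hu : u ^ N = 1)
    (h : ‖u - 1‖ < 1) : u = 1 := by
  by_contra hne
  have hs : ∑ i ∈ Finset.range N, u ^ i = 0 := by
    have := geom_sum_mul u N
    rw [hu, sub_self] at this
    exact (mul_eq_zero.mp this).resolve_right (sub_ne_zero.mpr hne)
  have h2 : ∑ i ∈ Finset.range N, (u ^ i - 1) = -(N : K) := by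
    rw [Finset.sum_sub_distrib, hs]; simp
  have h3 : ‖∑ i ∈ Finset.range N, (u ^ i - 1)‖ ≤ ‖u - 1‖ := by
    refine aux_sum_le (norm_nonneg _) fun i _ => ?_
    simpa using aux_pow_sub hu1 (norm_one (α := K)).le i
  rw [h2, norm_neg, hN] at h3
  linarith

theorem aux_deriv {p d : ℕ} (hd : 2 ≤ d) (hp0 : 0 < ‖(p : K)‖) (hp : ‖(p : K)‖ < 1)
    (z : K) (hz : ‖z‖ = 1) : ‖(P0 p d (K := K)).derivative.eval z‖ = ‖(p : K)‖ := by
  have h : (P0 p d (K := K)).derivative.eval z =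
      -((p : K) ^ d * (d * z ^ (d - 1))) + p * z ^ (p - 1) := by
    rw [P0, derivative_sub, derivative_C_mul, derivative_X_pow, derivative_X_pow]
    simp only [eval_sub, eval_mul, eval_C, eval_pow, eval_X]
    ring
  have h1 : ‖(p : K) * z ^ (p - 1)‖ = ‖(p : K)‖ := by simp [hz]
  have h2 : ‖-((p : K) ^ d * (d * z ^ (d - 1)))‖ < ‖(p : K)‖ := by
    have hdn : ‖(d : K)‖ ≤ 1 := IsUltrametricDist.norm_natCast_le_one K d
    rw [norm_neg]
    simp only [norm_mul, norm_pow, hz, one_pow, mul_one]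
    refine (mul_le_of_le_one_right (by positivity) hdn).trans_lt ?_
    exact pow_lt_self_of_lt_one₀ hp0 hp (by omega)
  rw [h, IsUltrametricDist.norm_add_eq_max_of_norm_ne_norm (by rw [h1]; exact h2.ne), h1]
  exact max_eq_right h2.le

end Helpers

theorem attracting_cycles_of_P0
    {K : Type*} [NontriviallyNormedField K] [IsAlgClosed K]
    [CompleteSpace K] [IsUltrametricDist K] [CharZero K]
    (p : ℕ) (hp2 : 2 ≤ p) (hpnorm : ‖(p : K)‖ < 1)
    (hpmin : ∀ m : ℕ, 2 ≤ m → ‖(m : K)‖ < 1 → p ≤ m)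
    (d : ℕ) (hd : 2 ≤ d) (hpd : p ≤ d) (hdiv : ¬ p ∣ d ∨ p ^ 2 ∣ d) :
    (∀ z : K, ‖z‖ = 1 → ‖(P0 p d (K := K)).derivative.eval z‖ = ‖(p : K)‖) ∧
    (∀ n : ℕ, 1 ≤ n → ∃ z : K, ‖z‖ = 1 ∧
      (fun w => (P0 p d (K := K)).eval w)^[n] z = z ∧
      (∀ m : ℕ, 1 ≤ m → m < n → (fun w => (P0 p d (K := K)).eval w)^[m] z ≠ z) ∧
      ‖∏ i ∈ Finset.range n,
          (P0 p d (K := K)).derivative.eval ((fun w => (P0 p d (K := K)).eval w)^[i] z)‖ =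
        ‖(p : K)‖ ^ n) := by
  have hp0 : 0 < ‖(p : K)‖ := norm_pos_iff.mpr (by exact_mod_cast (by omega : p ≠ 0))
  refine ⟨aux_deriv hd hp0 hpnorm, fun n hn => ?_⟩
  have hpn : 2 ≤ p ^ n := hp2.trans (Nat.le_self_pow (by omega) p)
  obtain ⟨N, hNdef⟩ : ∃ N, p ^ n = N + 1 := ⟨p ^ n - 1, by omega⟩
  have hN0 : N ≠ 0 := by omega
  have hNK : ‖(N : K)‖ = 1 := by
    have e : (N : K) - (-1) = (p : K) ^ n := by
      have : ((p ^ n : ℕ) : K) = ((N + 1 : ℕ) : K) := by rw [hNdef]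
      push_cast at this
      rw [this]; ring
    refine aux_norm_one (w := (-1 : K)) (by simp) ?_
    rw [e, norm_pow]
    exact pow_lt_one₀ (norm_nonneg _) hpnorm (by omega)
  haveI : NeZero (N : K) := ⟨by exact_mod_cast hN0⟩
  obtain ⟨ζ, hζ⟩ : ∃ ζ : K, IsPrimitiveRoot ζ N :=
    HasEnoughRootsOfUnity.exists_primitiveRoot K N
  have hζ1 : ‖ζ‖ = 1 := by
    have : ‖ζ‖ ^ N = 1 := by rw [← norm_pow, hζ.pow_eq_one, norm_one]
    exact (pow_eq_one_iff_of_nonneg (norm_nonneg _) hN0).mp this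
  have hζn : ζ ^ (p ^ n) = ζ := by rw [hNdef, pow_succ, hζ.pow_eq_one, one_mul]
  set f : K → K := fun w => (P0 p d (K := K)).eval w with hf
  have hd1 : 1 ≤ d := by omega
  obtain ⟨z, hzs, hzf⟩ : ∃ z : K, ‖z - ζ‖ ≤ ‖(p : K)‖ ∧ f^[n] z = z := by
    have hmaps : Set.MapsTo (f^[n]) (Metric.closedBall ζ ‖(p : K)‖)
        (Metric.closedBall ζ ‖(p : K)‖) := by
      intro x hx
      rw [mem_closedBall_iff_norm] at hx ⊢
      have := aux_iter_mem (d := d) hd1 hζ1 hpnorm hx n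
      rwa [hζn] at this
    have hc : ContractingWith ‖(p : K)‖₊ (hmaps.restrict (f^[n]) _ _) := by
      refine ⟨by exact_mod_cast hpnorm, LipschitzWith.of_dist_le_mul ?_⟩
      rintro ⟨x, hx⟩ ⟨y, hy⟩
      rw [mem_closedBall_iff_norm] at hx hy
      simp only [Subtype.dist_eq, Set.MapsTo.val_restrict_apply, dist_eq_norm, coe_nnnorm]
      refine (aux_iter_sub (d := d) hd1 hζ1 hpnorm hx hy n).trans ?_
      exact mul_le_mul_of_nonneg_right
        (pow_le_of_le_one (norm_nonneg _) hpnorm.le (by omega)) (norm_nonneg _)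
    obtain ⟨y, hy, hfy, -⟩ := ContractingWith.exists_fixedPoint'
      (Metric.isClosed_closedBall.isComplete) hmaps hc
      (Metric.mem_closedBall_self hp0.le) (edist_ne_top _ _)
    exact ⟨y, mem_closedBall_iff_norm.mp hy, hfy⟩
  have hmem := aux_iter_mem (d := d) hd1 hζ1 hpnorm hzs
  have horb : ∀ i, ‖f^[i] z‖ = 1 := fun i =>
    aux_norm_one (w := ζ ^ (p ^ i)) (by rw [norm_pow, hζ1, one_pow]) ((hmem i).trans_lt hpnorm)
  refine ⟨z, horb 0, hzf, fun m hm hmn heq => ?_, ?_⟩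
  · have h1 := hmem m
    change ‖f^[m] z - _‖ ≤ _ at h1
    rw [heq] at h1
    have h2 : ‖ζ ^ (p ^ m) - ζ‖ ≤ ‖(p : K)‖ := by
      have : ζ ^ (p ^ m) - ζ = (z - ζ) - (z - ζ ^ (p ^ m)) := by ring
      rw [this]
      exact aux_sub_le hzs h1
    have hpm : 2 ≤ p ^ m := hp2.trans (Nat.le_self_pow (by omega) p)
    obtain ⟨M, hM⟩ : ∃ M, p ^ m = M + 1 := ⟨p ^ m - 1, by omega⟩
    have h3 : ‖ζ ^ M - 1‖ < 1 := by
      have e : ζ ^ (p ^ m) - ζ = (ζ ^ M - 1) * ζ := by rw [hM]; ring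
      rw [e, norm_mul, hζ1, mul_one] at h2
      exact h2.trans_lt hpnorm
    have h4 : ζ ^ M = 1 := aux_root hNK (by rw [norm_pow, hζ1, one_pow])
      (by rw [← pow_mul, mul_comm, pow_mul, hζ.pow_eq_one, one_pow]) h3
    have h5 : N ≤ M := Nat.le_of_dvd (by omega) (hζ.dvd_of_pow_eq_one M h4)
    have h6 : p ^ m < p ^ n := Nat.pow_lt_pow_right (by omega) hmn
    omega
  · rw [norm_prod, Finset.prod_congr rfl (g := fun _ => ‖(p : K)‖)]
    · simp
    · exact fun i _ => aux_deriv hd hp0 hpnorm _ (horb i)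
end

section
/- (Attracting cycles of every period and arbitrarily small multiplier when λ(d) = 0: the example P_1) Suppose K has positive characteristic p, let d ≥ 2 be an integer with p ≤ d (so λ(d) = 0), and let η ∈ K with 0 < |η| < 1. Define P_1 := η·X + X^d if p divides d, and P_1 := η·X + X^p + η^{pd}·X^d if p does not divide d. Then: (a) for every z ∈ K with |z| ≤ 1 one has |P_1'(z)| = |η|; and (b) for every integer n ≥ 1 there exists z ∈ K with |z| ≤ 1 such that P_1^n(z) = z and P_1^m(z) ≠ z for every 1 ≤ m < n. Consequently, for each n ≥ 1 the polynomial P_1 has a cycle of period exactly n contained in the closed unit ball, whose multiplier has absolute value |η|^n < 1 (so the cycle is attracting, with arbitrarily small multiplier as |η| → 0). -/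
/-!
STATEMENT 15 (Attracting cycles of every period and arbitrarily small multiplier when
`lam d = 0`, example `P₁`): Suppose `K` has positive characteristic `p`, let `d ≥ 2`
with `p ≤ d`, and `η ∈ K` with `0 < ‖η‖ < 1`.  With `P₁ = η·X + X^d` if `p ∣ d` and
`P₁ = η·X + X^p + η^(pd)·X^d` otherwise: (a) `‖P₁'(z)‖ = ‖η‖` for every `‖z‖ ≤ 1`; and
(b) for every `n ≥ 1` there is a periodic point `z` of `P₁` of exact period `n` in the
closed unit ball, whose multiplier has norm `‖η‖^n`.
-/

open Polynomial Filter

/-- The polynomial `P₁`: `η·X + X^d` if `p ∣ d`, and `η·X + X^p + η^(pd)·X^d`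
otherwise. -/
noncomputable def P1 {K : Type*} [Field K] (p d : ℕ) (η : K) : Polynomial K :=
  if p ∣ d then Polynomial.C η * Polynomial.X + Polynomial.X ^ d
  else Polynomial.C η * Polynomial.X + Polynomial.X ^ p +
    Polynomial.C (η ^ (p * d)) * Polynomial.X ^ d

section helpers

variable {K : Type*} [NontriviallyNormedField K] [IsUltrametricDist K]

lemma um_add (x y : K) {r : ℝ} (hx : ‖x‖ ≤ r) (hy : ‖y‖ ≤ r) : ‖x + y‖ ≤ r :=
  (IsUltrametricDist.norm_add_le_max x y).trans (max_le hx hy)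

lemma um_sub (x y : K) {r : ℝ} (hx : ‖x‖ ≤ r) (hy : ‖y‖ ≤ r) : ‖x - y‖ ≤ r := by
  rw [sub_eq_add_neg]
  exact um_add _ _ hx (by rwa [norm_neg])

lemma pow_sub_le (x y : K) (hx : ‖x‖ ≤ 1) (hy : ‖y‖ ≤ 1) (k : ℕ) :
    ‖x ^ k - y ^ k‖ ≤ ‖x - y‖ := by
  induction k with
  | zero => simp
  | succ k ih =>
    have : x ^ (k+1) - y ^ (k+1) = (x ^ k - y ^ k) * x + y ^ k * (x - y) := by ring
    rw [this]
    apply um_add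
    · rw [norm_mul]
      exact (mul_le_of_le_one_right (norm_nonneg _) hx).trans ih
    · rw [norm_mul, norm_pow]
      exact mul_le_of_le_one_left (norm_nonneg _) (pow_le_one₀ (norm_nonneg _) hy)

lemma pow_sub_le_pow (p : ℕ) (hp : p.Prime) (hchar : CharP K p) (q : ℕ) (hq : p ∣ q)
    (x y : K) (hx : ‖x‖ ≤ 1) (hy : ‖y‖ ≤ 1) :
    ‖x ^ q - y ^ q‖ ≤ ‖x - y‖ ^ p := by
  obtain ⟨k, rfl⟩ := hq
  have := Fact.mk hp
  rw [mul_comm, pow_mul, pow_mul, ← sub_pow_char, norm_pow]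
  exact pow_le_pow_left₀ (norm_nonneg _) (pow_sub_le x y hx hy k) p

lemma main_aux [IsAlgClosed K] [CompleteSpace K]
    (p : ℕ) (hp : p.Prime) (hchar : CharP K p) (q : ℕ) (hq : p ∣ q) (hq2 : 2 ≤ q)
    (f : K → K) (r : ℝ) (hr0 : 0 < r) (hr1 : r < 1)
    (hf1 : ∀ x, ‖x‖ ≤ 1 → ‖f x - x ^ q‖ ≤ r)
    (hf2 : ∀ x y, ‖x‖ ≤ 1 → ‖y‖ ≤ 1 → ‖x - y‖ ≤ r → ‖f x - f y‖ ≤ r * ‖x - y‖)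
    (n : ℕ) (hn : 1 ≤ n) :
    (∀ (i : ℕ) (z : K), ‖z‖ ≤ 1 → ‖f^[i] z‖ ≤ 1) ∧
    ∃ z : K, ‖z‖ ≤ 1 ∧ f^[n] z = z ∧ ∀ m : ℕ, 1 ≤ m → m < n → f^[m] z ≠ z := by
  have hball : ∀ x, ‖x‖ ≤ 1 → ‖f x‖ ≤ 1 := by
    intro x hx
    have : f x = (f x - x ^ q) + x ^ q := by ring
    rw [this]
    refine um_add _ _ ((hf1 x hx).trans hr1.le) ?_
    rw [norm_pow]; exact pow_le_one₀ (norm_nonneg _) hx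
  have hiter : ∀ (i : ℕ) (z : K), ‖z‖ ≤ 1 → ‖f^[i] z‖ ≤ 1 := by
    intro i z hz
    induction i with
    | zero => simpa
    | succ i ih => rw [Function.iterate_succ_apply']; exact hball _ ih
  refine ⟨hiter, ?_⟩
  have hqn : q ≤ q ^ n := Nat.le_self_pow (by omega) q
  have hcast : ((q ^ n - 1 : ℕ) : K) = -1 := by
    have h0 : (q : K) = 0 := (CharP.cast_eq_zero_iff K p q).2 hq
    rw [Nat.cast_sub (by omega)]
    push_cast
    rw [h0, zero_pow (by omega)]; simp
  have : NeZero ((q ^ n - 1 : ℕ) : K) := ⟨by rw [hcast]; simp⟩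
  obtain ⟨ζ, hζ⟩ := HasEnoughRootsOfUnity.exists_primitiveRoot K (q ^ n - 1)
  have hζn : ζ ^ (q ^ n) = ζ := by
    have : q ^ n = (q ^ n - 1) + 1 := by omega
    rw [this, pow_succ, hζ.pow_eq_one, one_mul]
  have hζ1 : ‖ζ‖ = 1 := by
    have := congrArg norm hζ.pow_eq_one
    rw [norm_pow, norm_one] at this
    exact (pow_eq_one_iff_of_nonneg (norm_nonneg _) (by omega)).1 this
  -- tracking
  have htrack : ∀ (i : ℕ) (x : K), ‖x‖ ≤ 1 → ‖x - ζ‖ ≤ r → ‖f^[i] x - ζ ^ (q ^ i)‖ ≤ r := by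
    intro i x hx hxz
    induction i with
    | zero => simpa
    | succ i ih =>
      rw [Function.iterate_succ_apply', pow_succ, pow_mul]
      have e : f (f^[i] x) - (ζ ^ q ^ i) ^ q
        = (f (f^[i] x) - (f^[i] x) ^ q) + ((f^[i] x) ^ q - (ζ ^ q ^ i) ^ q) := by ring
      rw [e]
      refine um_add _ _ (hf1 _ (hiter i x hx)) ((pow_sub_le _ _ (hiter i x hx) ?_ q).trans ih)
      rw [norm_pow, hζ1, one_pow]
  have hcontr : ∀ (i : ℕ) (x y : K), ‖x‖ ≤ 1 → ‖y‖ ≤ 1 → ‖x - y‖ ≤ r →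
      ‖f^[i + 1] x - f^[i + 1] y‖ ≤ r * ‖x - y‖ := by
    intro i x y hx hy hxy
    induction i with
    | zero => simpa using hf2 x y hx hy hxy
    | succ i ih =>
      rw [Function.iterate_succ_apply' f (i+1), Function.iterate_succ_apply' f (i+1)]
      have h1 : ‖f^[i + 1] x - f^[i + 1] y‖ ≤ r :=
        ih.trans (by nlinarith [norm_nonneg (x - y)])
      refine (hf2 _ _ (hiter _ x hx) (hiter _ y hy) h1).trans ?_
      nlinarith [norm_nonneg (x - y), norm_nonneg (f^[i + 1] x - f^[i + 1] y)]
  have hin : ∀ x ∈ Metric.closedBall ζ r, ‖x‖ ≤ 1 := by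
    intro x hx
    rw [mem_closedBall_iff_norm] at hx
    have : x = (x - ζ) + ζ := by ring
    rw [this]
    exact um_add _ _ (hx.trans hr1.le) hζ1.le
  have hmaps : Set.MapsTo f^[n] (Metric.closedBall ζ r) (Metric.closedBall ζ r) := by
    intro x hx
    have h := htrack n x (hin x hx) (mem_closedBall_iff_norm.1 hx)
    rw [hζn] at h
    exact mem_closedBall_iff_norm.2 h
  have hcw : ContractingWith ⟨r, hr0.le⟩ (hmaps.restrict f^[n] _ _) := by
    refine ⟨by exact_mod_cast hr1, LipschitzWith.of_dist_le_mul ?_⟩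
    rintro ⟨x, hx⟩ ⟨y, hy⟩
    change dist (f^[n] x) (f^[n] y) ≤ r * dist x y
    rw [dist_eq_norm, dist_eq_norm]
    obtain ⟨i, rfl⟩ : ∃ i, n = i + 1 := ⟨n - 1, by omega⟩
    refine hcontr i x y (hin x hx) (hin y hy) ?_
    have e : x - y = (x - ζ) - (y - ζ) := by ring
    rw [e]
    exact um_sub _ _ (mem_closedBall_iff_norm.1 hx) (mem_closedBall_iff_norm.1 hy)
  obtain ⟨z, hz, hfix, -⟩ := hcw.exists_fixedPoint' Metric.isClosed_closedBall.isComplete hmaps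
    (Metric.mem_closedBall_self hr0.le) (edist_ne_top _ _)
  refine ⟨z, hin z hz, hfix, ?_⟩
  intro m hm hmn hmz
  have hzζ := mem_closedBall_iff_norm.1 hz
  have h1 := htrack m z (hin z hz) hzζ
  rw [hmz] at h1
  have h2 : ‖ζ ^ q ^ m - ζ‖ ≤ r := by
    have e : ζ ^ q ^ m - ζ = (z - ζ) - (z - ζ ^ q ^ m) := by ring
    rw [e]
    exact um_sub _ _ hzζ h1
  have hu : ‖ζ ^ q ^ m‖ ≤ 1 := by rw [norm_pow, hζ1, one_pow]
  have h3 := pow_sub_le_pow p hp hchar (q ^ n) (dvd_pow hq (by omega)) _ _ hu hζ1.le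
  rw [hζn, ← pow_mul, mul_comm, pow_mul, hζn] at h3
  have h4 : ‖ζ ^ q ^ m - ζ‖ ^ p ≤ ‖ζ ^ q ^ m - ζ‖ ^ 2 :=
    pow_le_pow_of_le_one (norm_nonneg _) (h2.trans hr1.le) hp.two_le
  have h5 : ‖ζ ^ q ^ m - ζ‖ = 0 := by nlinarith [norm_nonneg (ζ ^ q ^ m - ζ)]
  have h6 : ζ ^ q ^ m = ζ := sub_eq_zero.1 (norm_eq_zero.1 h5)
  have hqm : q ≤ q ^ m := Nat.le_self_pow (by omega) q
  have hlt : q ^ m < q ^ n := Nat.pow_lt_pow_right (by omega) hmn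
  have h7 : ζ ^ (q ^ m - 1) = 1 := by
    have hne : ζ ≠ 0 := by intro h; rw [h] at hζ1; simp at hζ1
    apply mul_right_cancel₀ hne
    rw [← pow_succ, Nat.sub_add_cancel (by omega), h6, one_mul]
  have := Nat.le_of_dvd (by omega) (hζ.dvd_of_pow_eq_one _ h7)
  omega

end helpers

theorem attracting_cycles_of_P1
    {K : Type*} [NontriviallyNormedField K] [IsAlgClosed K]
    [CompleteSpace K] [IsUltrametricDist K]
    (p : ℕ) (hp : p.Prime) (hchar : CharP K p)
    (d : ℕ) (hd : 2 ≤ d) (hpd : p ≤ d)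
    (η : K) (hη0 : 0 < ‖η‖) (hη1 : ‖η‖ < 1) :
    (∀ z : K, ‖z‖ ≤ 1 → ‖(P1 p d η).derivative.eval z‖ = ‖η‖) ∧
    (∀ n : ℕ, 1 ≤ n → ∃ z : K, ‖z‖ ≤ 1 ∧
      (fun w => (P1 p d η).eval w)^[n] z = z ∧
      (∀ m : ℕ, 1 ≤ m → m < n → (fun w => (P1 p d η).eval w)^[m] z ≠ z) ∧
      ‖∏ i ∈ Finset.range n,
          (P1 p d η).derivative.eval ((fun w => (P1 p d η).eval w)^[i] z)‖ =
        ‖η‖ ^ n) := by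
  have := Fact.mk hp
  have ha : ∀ z : K, ‖z‖ ≤ 1 → ‖(P1 p d η).derivative.eval z‖ = ‖η‖ := by
    intro z hz
    unfold P1
    split_ifs with h
    · have h0 : (d : K) = 0 := (CharP.cast_eq_zero_iff K p d).2 h
      simp [h0, derivative_X_pow]
    · have h0 : (p : K) = 0 := CharP.cast_eq_zero K p
      have e : eval z (derivative (C η * X + X ^ p + C (η ^ (p * d)) * X ^ d))
          = η + η ^ (p * d) * ((d : K) * z ^ (d - 1)) := by
        rw [derivative_add, derivative_add, derivative_C_mul, derivative_C_mul,
          derivative_X_pow, derivative_X_pow]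
        simp [h0]
      rw [e]
      have hlt : ‖η ^ (p * d) * ((d : K) * z ^ (d - 1))‖ < ‖η‖ := by
        rw [norm_mul, norm_mul, norm_pow, norm_pow]
        have h1 : ‖(d : K)‖ ≤ 1 := IsUltrametricDist.norm_natCast_le_one K d
        have h2 : ‖z‖ ^ (d - 1) ≤ 1 := pow_le_one₀ (norm_nonneg _) hz
        have h3 : ‖η‖ ^ (p * d) < ‖η‖ ^ 1 := by
          apply pow_lt_pow_right_of_lt_one₀ hη0 hη1
          nlinarith [hp.two_le]
        rw [pow_one] at h3
        refine lt_of_le_of_lt (mul_le_of_le_one_right (by positivity) ?_) h3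
        exact mul_le_one₀ h1 (by positivity) h2
      rw [IsUltrametricDist.norm_add_eq_max_of_norm_ne_norm hlt.ne', max_eq_left hlt.le]
  refine ⟨ha, fun n hn => ?_⟩
  have hpow : ∀ (q : ℕ), p ∣ q → ∀ x y : K, ‖x‖ ≤ 1 → ‖y‖ ≤ 1 → ‖x - y‖ ≤ ‖η‖ →
      ‖x ^ q - y ^ q‖ ≤ ‖η‖ * ‖x - y‖ := by
    intro q hq x y hx hy hxy
    refine (pow_sub_le_pow p hp hchar q hq x y hx hy).trans ?_
    refine (pow_le_pow_of_le_one (norm_nonneg _) (hxy.trans hη1.le) hp.two_le).trans ?_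
    nlinarith [norm_nonneg (x - y)]
  have key : (∀ (i : ℕ) (z : K), ‖z‖ ≤ 1 → ‖(fun w => (P1 p d η).eval w)^[i] z‖ ≤ 1) ∧
      ∃ z : K, ‖z‖ ≤ 1 ∧ (fun w => (P1 p d η).eval w)^[n] z = z ∧
        ∀ m : ℕ, 1 ≤ m → m < n → (fun w => (P1 p d η).eval w)^[m] z ≠ z := by
    by_cases h : p ∣ d
    · apply main_aux p hp hchar d h hd _ ‖η‖ hη0 hη1 _ _ n hn
      · intro x hx
        simp only [P1, if_pos h, eval_add, eval_mul, eval_C, eval_X, eval_pow,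
          add_sub_cancel_right, norm_mul]
        exact mul_le_of_le_one_right (norm_nonneg _) hx
      · intro x y hx hy hxy
        simp only [P1, if_pos h, eval_add, eval_mul, eval_C, eval_X, eval_pow]
        have e : η * x + x ^ d - (η * y + y ^ d) = η * (x - y) + (x ^ d - y ^ d) := by ring
        rw [e]
        exact um_add _ _ (norm_mul _ _).le (hpow d h x y hx hy hxy)
    · have hc : ‖η ^ (p * d)‖ ≤ ‖η‖ := by
        rw [norm_pow]
        exact pow_le_of_le_one (norm_nonneg _) hη1.le (Nat.mul_ne_zero hp.ne_zero (by omega))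
      apply main_aux p hp hchar p dvd_rfl hp.two_le _ ‖η‖ hη0 hη1 _ _ n hn
      · intro x hx
        simp only [P1, if_neg h, eval_add, eval_mul, eval_C, eval_X, eval_pow]
        have e : η * x + x ^ p + η ^ (p * d) * x ^ d - x ^ p = η * x + η ^ (p * d) * x ^ d := by
          ring
        rw [e]
        apply um_add
        · rw [norm_mul]; exact mul_le_of_le_one_right (norm_nonneg _) hx
        · rw [norm_mul, norm_pow x]
          exact (mul_le_of_le_one_right (norm_nonneg _)
            (pow_le_one₀ (norm_nonneg _) hx)).trans hc
      · intro x y hx hy hxy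
        simp only [P1, if_neg h, eval_add, eval_mul, eval_C, eval_X, eval_pow]
        have e : η * x + x ^ p + η ^ (p * d) * x ^ d - (η * y + y ^ p + η ^ (p * d) * y ^ d)
          = η * (x - y) + (x ^ p - y ^ p) + η ^ (p * d) * (x ^ d - y ^ d) := by ring
        rw [e]
        refine um_add _ _ (um_add _ _ (norm_mul _ _).le (hpow p dvd_rfl x y hx hy hxy)) ?_
        rw [norm_mul]
        exact mul_le_mul hc (pow_sub_le x y hx hy d) (norm_nonneg _) (norm_nonneg _)
  obtain ⟨hit, z, hz, hfix, hne⟩ := key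
  refine ⟨z, hz, hfix, hne, ?_⟩
  rw [norm_prod, Finset.prod_congr rfl (fun i _ => ha _ (hit i z hz))]
  simp
end

section
/- (The attracting cycles of P_1 attract no critical point) Suppose K has positive characteristic p, let d ≥ 2 be an integer with p ≤ d, and let η ∈ K with 0 < |η| < 1. Define P_1 := η·X + X^d if p divides d, and P_1 := η·X + X^p + η^{pd}·X^d if p does not divide d. Then: (i) if p divides d, the derivative P_1' is the nonzero constant η, so P_1 has no critical point in K; and (ii) if p does not divide d, then every c ∈ K with P_1'(c) = 0 satisfies |c| = |η|^{−(pd−1)/(d−1)} > 1, and |P_1^n(c)| → +∞ as n → +∞. In particular, in both cases no cycle of P_1 contained in the closed unit ball attracts a critical point of P_1, so when λ(d) = 0 there are attracting cycles of every period and arbitrarily small multiplier attracting no critical point. -/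
/-!
STATEMENT 16 (The attracting cycles of `P₁` attract no critical point): with `K`, `p`,
`d`, `η` as in Statement 15: (i) if `p ∣ d`, then `P₁' = C η` is a nonzero constant, so
`P₁` has no critical point; (ii) if `p ∤ d`, every critical point `c` of `P₁` satisfies
`‖c‖ = ‖η‖^(−(pd−1)/(d−1)) > 1` and `‖P₁^n(c)‖ → +∞`.
-/

open Polynomial Filter

lemma P1_norm_natCast_eq_one {K : Type*} [NontriviallyNormedField K]
    (p : ℕ) (hp : p.Prime) (hchar : CharP K p) (d : ℕ) (h : ¬ p ∣ d) : ‖(d : K)‖ = 1 := by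
  have : Fact p.Prime := ⟨hp⟩
  have h0 : (d : ZMod p) ≠ 0 := by
    rwa [Ne, ZMod.natCast_eq_zero_iff]
  have h1 := ZMod.pow_card_sub_one_eq_one h0
  have h2 : (d : K) ^ (p - 1) = 1 := by
    have := congrArg (ZMod.castHom (dvd_refl p) K) h1
    simpa using this
  have h3 : ‖(d : K)‖ ^ (p - 1) = 1 := by rw [← norm_pow, h2, norm_one]
  exact (pow_eq_one_iff_of_nonneg (norm_nonneg _) (by have := hp.two_le; omega)).1 h3

lemma P1_step {K : Type*} [NontriviallyNormedField K] [IsUltrametricDist K]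
    (p e : ℕ) (hp : 2 ≤ p) (η z : K) (hη1 : ‖η‖ < 1)
    (hz : 1 < ‖z‖) (hne : ‖η‖ ^ (p * (p + e)) * ‖z‖ ^ e ≠ 1) :
    ‖η * z + z ^ p + η ^ (p * (p + e)) * z ^ (p + e)‖ =
      max (‖z‖ ^ p) (‖z‖ ^ p * (‖η‖ ^ (p * (p + e)) * ‖z‖ ^ e)) := by
  have hS : 0 < ‖z‖ ^ p := by positivity
  have e1 : ‖η ^ (p * (p + e)) * z ^ (p + e)‖ =
      ‖z‖ ^ p * (‖η‖ ^ (p * (p + e)) * ‖z‖ ^ e) := by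
    rw [norm_mul, norm_pow, norm_pow, pow_add ‖z‖]; ring
  have e2 : ‖z ^ p + η ^ (p * (p + e)) * z ^ (p + e)‖ =
      max (‖z‖ ^ p) (‖z‖ ^ p * (‖η‖ ^ (p * (p + e)) * ‖z‖ ^ e)) := by
    rw [IsUltrametricDist.norm_add_eq_max_of_norm_ne_norm, e1, norm_pow]
    rw [e1, norm_pow]
    intro h
    exact hne (mul_left_cancel₀ hS.ne' (by rw [← h, mul_one]))
  have e3 : ‖η * z‖ < ‖z ^ p + η ^ (p * (p + e)) * z ^ (p + e)‖ := by
    rw [e2]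
    refine lt_of_lt_of_le ?_ (le_max_left _ _)
    rw [norm_mul]
    have : ‖z‖ ^ 1 ≤ ‖z‖ ^ p := pow_le_pow_right₀ hz.le (by omega)
    nlinarith
  rw [add_assoc, IsUltrametricDist.norm_add_eq_max_of_norm_ne_norm e3.ne, max_eq_right e3.le, e2]

lemma P1_noteq (p e n : ℕ) (hp : 2 ≤ p) (r R : ℝ) (hr0 : 0 < r) (hr1 : r < 1)
    (h : r ^ (p * (p + e) - 1) * R ^ (p + e - 1) = 1) :
    r ^ (p * (p + e)) * (R ^ (p ^ n)) ^ e ≠ 1 := by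
  intro h'
  have a : (r ^ (p * (p + e) - 1) * R ^ (p + e - 1)) ^ (p ^ n * e) = 1 := by rw [h, one_pow]
  have b : (r ^ (p * (p + e)) * (R ^ (p ^ n)) ^ e) ^ (p + e - 1) = 1 := by rw [h', one_pow]
  have hR : R ≠ 0 := by
    rintro rfl
    rw [zero_pow (by omega)] at h
    simp at h
  rw [mul_pow, ← pow_mul, ← pow_mul] at a
  rw [mul_pow, ← pow_mul, ← pow_mul, ← pow_mul, ← mul_assoc (p ^ n),
    mul_comm (p ^ n * e)] at b
  have c := mul_right_cancel₀ (pow_ne_zero _ hR) (a.trans b.symm)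
  have c' := pow_right_injective₀ hr0 hr1.ne c
  have hpd : p + e < p * (p + e) := by nlinarith
  have dv : (p * (p + e) - 1) ∣ p * (p + e) * (p + e - 1) := ⟨_, c'.symm⟩
  have cop : Nat.Coprime (p * (p + e) - 1) (p * (p + e)) := by
    obtain ⟨m, hm⟩ : ∃ m, p * (p + e) = m + 1 := ⟨p * (p + e) - 1, by omega⟩
    rw [hm]; simp
  have := Nat.le_of_dvd (by omega) (cop.dvd_of_dvd_mul_left dv)
  omega

theorem critical_points_of_P1_escape
    {K : Type*} [NontriviallyNormedField K] [IsAlgClosed K]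
    [CompleteSpace K] [IsUltrametricDist K]
    (p : ℕ) (hp : p.Prime) (hchar : CharP K p)
    (d : ℕ) (hd : 2 ≤ d) (hpd : p ≤ d)
    (η : K) (hη0 : 0 < ‖η‖) (hη1 : ‖η‖ < 1) :
    (p ∣ d →
      (P1 p d η).derivative = Polynomial.C η ∧
      ∀ c : K, (P1 p d η).derivative.eval c ≠ 0) ∧
    (¬ p ∣ d → ∀ c : K, (P1 p d η).derivative.eval c = 0 →
      ‖c‖ = ‖η‖ ^ (-(((p : ℝ) * (d : ℝ) - 1) / ((d : ℝ) - 1))) ∧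
      1 < ‖c‖ ∧
      Tendsto (fun n => ‖(fun w => (P1 p d η).eval w)^[n] c‖) atTop atTop) := by
  constructor
  · intro h
    have h1 : (P1 p d η).derivative = Polynomial.C η := by
      have : (d : K) = 0 := (CharP.cast_eq_zero_iff K p d).2 h
      simp [P1, h, this, derivative_X_pow]
    refine ⟨h1, fun c => ?_⟩
    rw [h1, eval_C]
    exact norm_pos_iff.1 hη0
  · intro h c hc
    have hp2 := hp.two_le
    have hlt : p < d := lt_of_le_of_ne hpd (fun h' => h (h' ▸ dvd_refl _))
    have hdn := P1_norm_natCast_eq_one p hp hchar d h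
    obtain ⟨e, rfl⟩ : ∃ e, d = p + e := ⟨d - p, by omega⟩
    have hP : ∀ z : K, (P1 p (p + e) η).eval z =
        η * z + z ^ p + η ^ (p * (p + e)) * z ^ (p + e) := by
      intro z
      rw [P1, if_neg h]; simp
    have hc2 : η + η ^ (p * (p + e)) * (((p + e : ℕ) : K) * c ^ (p + e - 1)) = 0 := by
      have hp0 : (p : K) = 0 := CharP.cast_eq_zero K p
      rw [P1, if_neg h] at hc
      simpa [hp0, derivative_X_pow, -map_pow] using hc
    have hη : η ≠ 0 := norm_pos_iff.1 hη0
    have hpos : 0 < p * (p + e) := by positivity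
    have hkey : ‖η‖ ^ (p * (p + e) - 1) * ‖c‖ ^ (p + e - 1) = 1 := by
      have h1 := congrArg norm (eq_neg_of_add_eq_zero_right hc2)
      rw [norm_neg, norm_mul, norm_mul, hdn, one_mul, norm_pow, norm_pow] at h1
      refine mul_left_cancel₀ hη0.ne' ?_
      rw [← mul_assoc, ← pow_succ', Nat.sub_add_cancel hpos, h1, mul_one]
    have hR1 : 1 < ‖c‖ := by
      by_contra hle
      have h1 : ‖c‖ ^ (p + e - 1) ≤ 1 := pow_le_one₀ (norm_nonneg _) (not_lt.1 hle)
      have h2 : ‖η‖ ^ (p * (p + e) - 1) < 1 :=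
        pow_lt_one₀ hη0.le hη1 (by have : p + e ≤ p * (p + e) := Nat.le_mul_of_pos_left _ (by omega)
                                   omega)
      have h3 : 0 < ‖η‖ ^ (p * (p + e) - 1) := by positivity
      nlinarith
    refine ⟨?_, hR1, ?_⟩
    · have hd1 : (((p + e : ℕ) : ℝ) - 1) = ((p + e - 1 : ℕ) : ℝ) := by
        rw [Nat.cast_sub (by omega)]; simp
      have hd2 : ((p : ℝ) * ((p + e : ℕ) : ℝ) - 1) = ((p * (p + e) - 1 : ℕ) : ℝ) := by
        rw [Nat.cast_sub (by omega)]; push_cast; ring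
      have hne : p + e - 1 ≠ 0 := by omega
      rw [hd1, hd2]
      refine (pow_left_inj₀ (norm_nonneg _) (by positivity) hne).1 ?_
      rw [← Real.rpow_natCast (_ ^ (_ : ℝ)), ← Real.rpow_mul hη0.le, neg_mul,
        div_mul_cancel₀ _ (by exact_mod_cast hne), Real.rpow_neg hη0.le, Real.rpow_natCast]
      exact eq_inv_of_mul_eq_one_right hkey
    · have inv : ∀ n : ℕ, ‖c‖ ^ (n + 1) ≤ ‖(fun w => (P1 p (p + e) η).eval w)^[n] c‖ ∧
          (‖(fun w => (P1 p (p + e) η).eval w)^[n] c‖ = ‖c‖ ^ (p ^ n) ∨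
            1 < ‖η‖ ^ (p * (p + e)) * ‖(fun w => (P1 p (p + e) η).eval w)^[n] c‖ ^ e) := by
        intro n
        induction n with
        | zero => simp
        | succ n ih =>
          rw [Function.iterate_succ_apply']
          generalize (fun w => (P1 p (p + e) η).eval w)^[n] c = z at ih ⊢
          obtain ⟨ih1, ih2⟩ := ih
          have hz : 1 < ‖z‖ := lt_of_lt_of_le (one_lt_pow₀ hR1 (by omega)) ih1
          have hne : ‖η‖ ^ (p * (p + e)) * ‖z‖ ^ e ≠ 1 := by
            rcases ih2 with h2 | h2
            · rw [h2]; exact P1_noteq p e n hp2 _ _ hη0 hη1 hkey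
            · exact h2.ne'
          have hs := P1_step p e hp2 η z hη1 hz hne
          have hcz : ‖c‖ ≤ ‖z‖ := le_trans (le_self_pow₀ hR1.le (by omega)) ih1
          have hzp : ‖z‖ ^ 2 ≤ ‖z‖ ^ p := pow_le_pow_right₀ hz.le hp2
          simp only [hP, hs]
          refine ⟨?_, ?_⟩
          · refine le_trans ?_ (le_max_left _ _)
            refine le_trans ?_ hzp
            rw [pow_succ, sq]
            exact mul_le_mul ih1 hcz (norm_nonneg _) (norm_nonneg _)
          · rcases lt_or_gt_of_ne hne with h3 | h3
            · left
              rcases ih2 with h2 | h2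
              · rw [max_eq_left (mul_le_of_le_one_right (by positivity) h3.le), h2, ← pow_mul,
                  ← pow_succ]
              · exact absurd h2 (not_lt.2 h3.le)
            · right
              refine lt_of_lt_of_le h3 ?_
              have h4 : ‖z‖ ≤ max (‖z‖ ^ p) (‖z‖ ^ p * (‖η‖ ^ (p * (p + e)) * ‖z‖ ^ e)) :=
                le_trans (le_self_pow₀ hz.le (by omega)) (le_max_left _ _)
              gcongr
      refine tendsto_atTop_mono (fun n => (inv n).1) ?_
      exact (tendsto_pow_atTop_atTop_of_one_lt hR1).comp (tendsto_add_atTop_nat 1)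
end
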